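/- Let k be an algebraically closed field of characteristic 2 and let G = Sp(2n, k) with n ≥ 2. A non-trivial unipotent conjugacy class O of G is spherical if and only if O consists of involutions, i.e. if and only if every u ∈ O satisfies u² = 1. -/

import Mathlib

open scoped Matrix

section SphericalDefs

variable (G : Type*) [Group G] [TopologicalSpace G]

/-- A Borel subgroup of an algebraic group: a maximal closed connected solvable subgroup. -/
def IsBorel (B : Subgroup G) : Prop :=
  IsClosed (B : Set G) ∧ IsConnected (B : Set G) ∧ IsSolvable B ∧
    ∀ B' : Subgroup G, IsClosed (B' : Set G) → IsConnected (B' : Set G) → IsSolvable B' →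
      B ≤ B' → B' = B

variable {G}

/-- The orbit of `x` under conjugation by elements of a subgroup `B`. -/
def conjOrbit (B : Subgroup G) (x : G) : Set G := {g | ∃ b ∈ B, g = b * x * b⁻¹}

/-- The conjugacy class of `u`. -/
def conjClass (u : G) : Set G := {v | IsConj u v}

variable (G)

/-- A subset (typically a conjugacy class) of `G` is *spherical* if a Borel subgroup of `G`
has a dense orbit on it (acting by conjugation). -/
def IsSphericalClass (O : Set G) : Prop :=
  ∃ B : Subgroup G, IsBorel G B ∧ ∃ x ∈ O, O ⊆ closure (conjOrbit B x)

/-- A subgroup `H ≤ G` is a *spherical subgroup* if a Borel subgroup of `G` has a dense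
orbit on the homogeneous space `G ⧸ H`, i.e. `G ⧸ H` is a spherical homogeneous space. -/
def IsSphericalSubgroup (H : Subgroup G) : Prop :=
  ∃ B : Subgroup G, IsBorel G B ∧ ∃ x : G ⧸ H, Dense {y : G ⧸ H | ∃ b ∈ B, y = b • x}

end SphericalDefs

/-- The (classical) Zariski topology on the affine space `ι → k`:
a basis of open sets is given by the nonvanishing loci of polynomials. -/
def zariskiTopology (k : Type*) [CommRing k] (ι : Type*) : TopologicalSpace (ι → k) :=
  TopologicalSpace.generateFrom
    {s | ∃ p : MvPolynomial ι k, s = {v | MvPolynomial.eval v p ≠ 0}}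

/-- The Zariski topology on the general linear group `GL m k`, viewing it as an affine
variety via `g ↦ (g, g⁻¹)`. -/
instance glZariskiTopology (m k : Type*) [DecidableEq m] [Fintype m] [CommRing k] :
    TopologicalSpace (GL m k) :=
  TopologicalSpace.induced
    (fun g => Sum.elim (fun p : m × m => ((g : Matrix m m k)) p.1 p.2)
      (fun p : m × m => (((g⁻¹ : GL m k) : Matrix m m k)) p.1 p.2))
    (zariskiTopology k ((m × m) ⊕ (m × m)))

noncomputable section

variable (k : Type*) [Field k] (n : ℕ)

private lemma glInvVec {k : Type*} [Field k] {m : Type*} [DecidableEq m] [Fintype m]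
    (g : GL m k) (u : m → k) :
    (g : Matrix m m k) *ᵥ (((g⁻¹ : GL m k) : Matrix m m k) *ᵥ u) = u := by
  rw [Matrix.mulVec_mulVec, ← Units.val_mul, mul_inv_cancel, Units.val_one,
    Matrix.one_mulVec]

/-- The standard nondegenerate alternating bilinear form on `k^{2n}`. -/
def sympForm (v w : (Fin n ⊕ Fin n) → k) : k :=
  ∑ i : Fin n, (v (Sum.inl i) * w (Sum.inr i) - v (Sum.inr i) * w (Sum.inl i))

/-- The symplectic group `Sp(2n, k)`: the subgroup of `GL(2n, k)` preserving the
standard nondegenerate alternating bilinear form. -/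
def SpGroup : Subgroup (GL (Fin n ⊕ Fin n) k) where
  carrier := {g : GL (Fin n ⊕ Fin n) k | ∀ v w : (Fin n ⊕ Fin n) → k,
      sympForm k n ((g : Matrix (Fin n ⊕ Fin n) (Fin n ⊕ Fin n) k) *ᵥ v)
        ((g : Matrix (Fin n ⊕ Fin n) (Fin n ⊕ Fin n) k) *ᵥ w) = sympForm k n v w}
  mul_mem' := by
    intro a b ha hb v w
    simp only [Units.val_mul, ← Matrix.mulVec_mulVec]
    rw [ha, hb]
  one_mem' := by
    intro v w
    simp [Matrix.one_mulVec]
  inv_mem' := by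
    intro g hg v w
    conv_rhs => rw [← glInvVec g v, ← glInvVec g w, hg]

namespace SympCharTwo

section Regular

variable {k n}

/-- The matrix underlying an element of the symplectic group. -/
abbrev mat (g : SpGroup k n) : Matrix (Fin n ⊕ Fin n) (Fin n ⊕ Fin n) k :=
  ((g : GL (Fin n ⊕ Fin n) k) : Matrix (Fin n ⊕ Fin n) (Fin n ⊕ Fin n) k)

/-- The entries of `g` and `g⁻¹`, the affine coordinates on the symplectic group. -/
def coords (g : SpGroup k n) :
    ((Fin n ⊕ Fin n) × (Fin n ⊕ Fin n)) ⊕ ((Fin n ⊕ Fin n) × (Fin n ⊕ Fin n)) → k :=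
  Sum.elim (fun p => mat g p.1 p.2) (fun p => mat g⁻¹ p.1 p.2)

/-- Regular functions on the symplectic group. -/
def IsReg (F : SpGroup k n → k) : Prop :=
  ∃ p : MvPolynomial _ k, ∀ g, F g = MvPolynomial.eval (coords g) p

lemma IsReg.const (c : k) : IsReg (fun _ : SpGroup k n => c) :=
  ⟨MvPolynomial.C c, fun g => by simp⟩

lemma IsReg.add {F F' : SpGroup k n → k} (h : IsReg F) (h' : IsReg F') :
    IsReg (fun g => F g + F' g) := by
  obtain ⟨p, hp⟩ := h
  obtain ⟨q, hq⟩ := h'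
  exact ⟨p + q, fun g => by simp [hp, hq]⟩

lemma IsReg.mul {F F' : SpGroup k n → k} (h : IsReg F) (h' : IsReg F') :
    IsReg (fun g => F g * F' g) := by
  obtain ⟨p, hp⟩ := h
  obtain ⟨q, hq⟩ := h'
  exact ⟨p * q, fun g => by simp [hp, hq]⟩

lemma IsReg.sub {F F' : SpGroup k n → k} (h : IsReg F) (h' : IsReg F') :
    IsReg (fun g => F g - F' g) := by
  obtain ⟨p, hp⟩ := h
  obtain ⟨q, hq⟩ := h'
  exact ⟨p - q, fun g => by simp [hp, hq]⟩

lemma IsReg.sum {ι : Type*} (s : Finset ι) {F : ι → SpGroup k n → k}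
    (h : ∀ i ∈ s, IsReg (F i)) : IsReg (fun g => ∑ i ∈ s, F i g) := by
  classical
  induction s using Finset.induction_on with
  | empty => simpa using IsReg.const (k := k) (n := n) 0
  | insert a s ha ih =>
    simp only [Finset.sum_insert ha]
    exact (h a (by simp)).add (ih fun i hi => h i (by simp [hi]))

lemma isReg_entry (a b : Fin n ⊕ Fin n) : IsReg (fun g : SpGroup k n => mat g a b) :=
  ⟨MvPolynomial.X (Sum.inl (a, b)), fun g => by simp [coords]⟩

lemma isReg_inv_entry (a b : Fin n ⊕ Fin n) : IsReg (fun g : SpGroup k n => mat g⁻¹ a b) :=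
  ⟨MvPolynomial.X (Sum.inr (a, b)), fun g => by simp [coords]⟩

/-- A self-map of the symplectic group whose matrix entries are regular. -/
def IsRegMap (f : SpGroup k n → SpGroup k n) : Prop := ∀ a b, IsReg (fun g => mat (f g) a b)

lemma mat_mul (g h : SpGroup k n) : mat (g * h) = mat g * mat h := rfl

lemma IsRegMap.mul {f f' : SpGroup k n → SpGroup k n} (h : IsRegMap f) (h' : IsRegMap f') :
    IsRegMap (fun g => f g * f' g) := by
  intro a b
  simp only [mat_mul, Matrix.mul_apply]
  exact IsReg.sum _ fun i _ => (h a i).mul (h' i b)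

lemma IsRegMap.const (h : SpGroup k n) : IsRegMap (fun _ : SpGroup k n => h) :=
  fun _ _ => IsReg.const _

lemma isRegMap_id : IsRegMap (fun g : SpGroup k n => g) := isReg_entry

lemma isRegMap_inv : IsRegMap (fun g : SpGroup k n => g⁻¹) := isReg_inv_entry

lemma isReg_sympForm (v w : Fin n ⊕ Fin n → k) {f : SpGroup k n → SpGroup k n}
    (hf : IsRegMap f) : IsReg (fun g => sympForm k n v (mat (f g) *ᵥ w)) := by
  have key : ∀ a, IsReg (fun g => (mat (f g) *ᵥ w) a) := fun a => by
    simp only [Matrix.mulVec, dotProduct]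
    exact IsReg.sum _ fun i _ => (hf a i).mul (IsReg.const _)
  unfold sympForm
  exact IsReg.sum _ fun i _ => ((IsReg.const _).mul (key _)).sub ((IsReg.const _).mul (key _))

lemma isOpen_ne_zero {F : SpGroup k n → k} (h : IsReg F) : IsOpen {g | F g ≠ 0} := by
  obtain ⟨p, hp⟩ := h
  refine ⟨{g : GL (Fin n ⊕ Fin n) k | MvPolynomial.eval
    (Sum.elim (fun p => (g : Matrix _ _ k) p.1 p.2)
      (fun p => ((g⁻¹ : GL (Fin n ⊕ Fin n) k) : Matrix _ _ k) p.1 p.2)) p ≠ 0}, ?_, ?_⟩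
  · exact ⟨_, TopologicalSpace.isOpen_generateFrom_of_mem ⟨p, rfl⟩, rfl⟩
  · ext g
    simp only [Set.mem_preimage, Set.mem_ofPred_eq, hp]
    rfl

lemma isClosed_eq_zero {F : SpGroup k n → k} (h : IsReg F) : IsClosed {g | F g = 0} := by
  have := (isOpen_ne_zero h).isClosed_compl
  convert this using 1
  ext g
  simp

lemma exists_isReg_of_isOpen {U : Set (SpGroup k n)} (hU : IsOpen U) {g : SpGroup k n}
    (hg : g ∈ U) : ∃ F : SpGroup k n → k, IsReg F ∧ F g ≠ 0 ∧ ∀ h, F h ≠ 0 → h ∈ U := by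
  obtain ⟨V, ⟨W, hW, rfl⟩, rfl⟩ := hU
  have key : ∀ W : Set (((Fin n ⊕ Fin n) × (Fin n ⊕ Fin n)) ⊕
      ((Fin n ⊕ Fin n) × (Fin n ⊕ Fin n)) → k),
      TopologicalSpace.GenerateOpen
        {s | ∃ p : MvPolynomial _ k, s = {v | MvPolynomial.eval v p ≠ 0}} W →
      ∀ v ∈ W, ∃ p : MvPolynomial _ k, MvPolynomial.eval v p ≠ 0 ∧
        ∀ w, MvPolynomial.eval w p ≠ 0 → w ∈ W := by
    intro W hW
    induction hW with
    | basic s hs =>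
      obtain ⟨p, rfl⟩ := hs
      exact fun v hv => ⟨p, hv, fun w hw => hw⟩
    | univ => exact fun v _ => ⟨1, by simp, fun w _ => trivial⟩
    | inter s t _ _ hs ht =>
      intro v hv
      obtain ⟨p, hp, hp'⟩ := hs v hv.1
      obtain ⟨q, hq, hq'⟩ := ht v hv.2
      refine ⟨p * q, by simp [hp, hq], fun w hw => ?_⟩
      simp only [map_mul, ne_eq, mul_eq_zero, not_or] at hw
      exact ⟨hp' w hw.1, hq' w hw.2⟩
    | sUnion S _ hS =>
      rintro v ⟨s, hs, hv⟩
      obtain ⟨p, hp, hp'⟩ := hS s hs v hv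
      exact ⟨p, hp, fun w hw => ⟨s, hs, hp' w hw⟩⟩
  obtain ⟨p, hp, hp'⟩ := key W hW _ hg
  exact ⟨fun h => MvPolynomial.eval (coords h) p, ⟨p, fun _ => rfl⟩, hp, fun h hh => hp' _ hh⟩

end Regular

end SympCharTwo

namespace SympCharTwo

section Symp

variable {k n}

lemma sympForm_eq (v w : Fin n ⊕ Fin n → k) :
    sympForm k n v w = -(v ⬝ᵥ (Matrix.J (Fin n) k *ᵥ w)) := by
  have h : ∀ a, (Matrix.J (Fin n) k *ᵥ w) a =
      Sum.elim (fun i => -w (Sum.inr i)) (fun i => w (Sum.inl i)) a := by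
    intro a
    have := Matrix.fromBlocks_mulVec (0 : Matrix (Fin n) (Fin n) k)
      (-1 : Matrix (Fin n) (Fin n) k) (1 : Matrix (Fin n) (Fin n) k)
      (0 : Matrix (Fin n) (Fin n) k) w
    rw [Matrix.J, this]
    rcases a with i | i <;> simp [Matrix.neg_mulVec]
  simp only [sympForm, dotProduct, h, Fintype.sum_sum_type, Sum.elim_inl, Sum.elim_inr,
    Finset.sum_sub_distrib]
  simp [Finset.sum_neg_distrib]
  ring

lemma preserves_iff (A : Matrix (Fin n ⊕ Fin n) (Fin n ⊕ Fin n) k) :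
    (∀ v w, sympForm k n (A *ᵥ v) (A *ᵥ w) = sympForm k n v w) ↔
      Aᵀ * Matrix.J (Fin n) k * A = Matrix.J (Fin n) k := by
  have h : ∀ v w, sympForm k n (A *ᵥ v) (A *ᵥ w) =
      -(v ⬝ᵥ ((Aᵀ * Matrix.J (Fin n) k * A) *ᵥ w)) := by
    intro v w
    rw [sympForm_eq, ← Matrix.mulVec_mulVec, ← Matrix.mulVec_mulVec, Matrix.dotProduct_mulVec v,
      Matrix.vecMul_transpose]
  constructor
  · intro H
    ext a b
    have := H (Pi.single a 1) (Pi.single b 1)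
    rw [h, sympForm_eq, neg_inj] at this
    simpa using this
  · intro H v w
    rw [h, H, sympForm_eq]

lemma mat_mem (g : SpGroup k n) : mat g ∈ Matrix.symplecticGroup (Fin n) k :=
  SymplecticGroup.mem_iff'.2 ((preserves_iff _).1 g.2)

/-- The element of the symplectic group given by a symplectic matrix. -/
def mk (A : Matrix (Fin n ⊕ Fin n) (Fin n ⊕ Fin n) k)
    (hA : ∀ v w, sympForm k n (A *ᵥ v) (A *ᵥ w) = sympForm k n v w) : SpGroup k n :=
  ⟨Matrix.GeneralLinearGroup.mk'' A
    (SymplecticGroup.symplectic_det (SymplecticGroup.mem_iff'.2 ((preserves_iff _).1 hA))), hA⟩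

@[simp] lemma mat_mk (A : Matrix (Fin n ⊕ Fin n) (Fin n ⊕ Fin n) k) (hA) :
    mat (mk A hA) = A := rfl

@[simp] lemma mat_one : mat (1 : SpGroup k n) = 1 := rfl

lemma mat_mul_inv (g : SpGroup k n) : mat g * mat g⁻¹ = 1 := by
  rw [← mat_mul, mul_inv_cancel, mat_one]

lemma mat_inv_mul (g : SpGroup k n) : mat g⁻¹ * mat g = 1 := by
  rw [← mat_mul, inv_mul_cancel, mat_one]

lemma mat_injective : Function.Injective (mat : SpGroup k n → _) :=
  fun _ _ h => Subtype.ext (Units.ext h)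

lemma mat_inv (g : SpGroup k n) :
    mat g⁻¹ = -(Matrix.J (Fin n) k * (mat g)ᵀ * Matrix.J (Fin n) k) := by
  have h := SymplecticGroup.inv_left_mul_aux (mat_mem g)
  calc mat g⁻¹ = (-(Matrix.J (Fin n) k * (mat g)ᵀ * Matrix.J (Fin n) k * mat g)) * mat g⁻¹ := by
        rw [h, one_mul]
    _ = _ := by rw [neg_mul, mul_assoc _ (mat g), mat_mul_inv, mul_one]

lemma IsRegMap.inv {f : SpGroup k n → SpGroup k n} (hf : IsRegMap f) :
    IsRegMap (fun g => (f g)⁻¹) := by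
  intro a b
  have : ∀ A B : Matrix (Fin n ⊕ Fin n) (Fin n ⊕ Fin n) k,
      IsReg (fun g => (-(A * (mat (f g))ᵀ * B)) a b) := by
    intro A B
    have : ∀ g, (-(A * (mat (f g))ᵀ * B)) a b =
        0 - ∑ j, (∑ i, A a i * mat (f g) j i) * B j b := by
      intro g
      simp [Matrix.mul_apply]
    simp only [this]
    exact (IsReg.const 0).sub (IsReg.sum _ fun j _ =>
      (IsReg.sum _ fun i _ => (IsReg.const _).mul (hf j i)).mul (IsReg.const _))
  simpa only [mat_inv] using this _ _

lemma IsReg.comp {F : SpGroup k n → k} (hF : IsReg F) {f : SpGroup k n → SpGroup k n}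
    (hf : IsRegMap f) : IsReg (fun g => F (f g)) := by
  obtain ⟨p, hp⟩ := hF
  have hc : ∀ i, IsReg (fun g => coords (f g) i) := by
    rintro (⟨a, b⟩ | ⟨a, b⟩)
    · exact hf a b
    · exact hf.inv a b
  choose q hq using hc
  refine ⟨MvPolynomial.bind₁ q p, fun g => ?_⟩
  change F (f g) = _
  have hb : MvPolynomial.eval (coords g) (MvPolynomial.bind₁ q p) =
      MvPolynomial.eval (fun i => MvPolynomial.eval (coords g) (q i)) p :=
    MvPolynomial.eval₂Hom_bind₁ _ _ _ _
  rw [hp, hb]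
  congr 2
  ext i
  exact hq i g

lemma IsRegMap.continuous {f : SpGroup k n → SpGroup k n} (hf : IsRegMap f) : Continuous f := by
  refine continuous_def.2 fun U hU => isOpen_iff_mem_nhds.2 fun g hg => ?_
  obtain ⟨F, hF, hg', hFU⟩ := exists_isReg_of_isOpen hU hg
  exact Filter.mem_of_superset ((isOpen_ne_zero (hF.comp hf)).mem_nhds hg') fun h hh => hFU _ hh

lemma sympForm_self (v : Fin n ⊕ Fin n → k) : sympForm k n v v = 0 :=
  Finset.sum_eq_zero fun i _ => by ring

/-- The symplectic form as a bilinear map. -/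
def form : (Fin n ⊕ Fin n → k) →ₗ[k] (Fin n ⊕ Fin n → k) →ₗ[k] k :=
  LinearMap.mk₂ k (sympForm k n)
    (fun _ _ _ => by
      simp only [sympForm, Pi.add_apply, ← Finset.sum_add_distrib]
      exact Finset.sum_congr rfl fun _ _ => by ring)
    (fun _ _ _ => by
      simp only [sympForm, Pi.smul_apply, smul_eq_mul, Finset.mul_sum]
      exact Finset.sum_congr rfl fun _ _ => by ring)
    (fun _ _ _ => by
      simp only [sympForm, Pi.add_apply, ← Finset.sum_add_distrib]
      exact Finset.sum_congr rfl fun _ _ => by ring)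
    (fun _ _ _ => by
      simp only [sympForm, Pi.smul_apply, smul_eq_mul, Finset.mul_sum]
      exact Finset.sum_congr rfl fun _ _ => by ring)

lemma form_apply (v w : Fin n ⊕ Fin n → k) : form v w = sympForm k n v w := rfl

lemma form_self (v : Fin n ⊕ Fin n → k) : form v v = 0 := sympForm_self v

lemma form_neg_comm (v w : Fin n ⊕ Fin n → k) : form v w = -form w v := by
  simp only [form_apply, sympForm, ← Finset.sum_neg_distrib]
  exact Finset.sum_congr rfl fun _ _ => by ring

lemma form_mat (g : SpGroup k n) (v w : Fin n ⊕ Fin n → k) :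
    form (mat g *ᵥ v) (mat g *ᵥ w) = form v w := g.2 v w

/-- The symplectic form represents every linear functional. -/
lemma exists_form_eq (φ : Module.Dual k (Fin n ⊕ Fin n → k)) :
    ∃ z, ∀ v, form z v = φ v := by
  refine ⟨Sum.elim (fun i => φ (Pi.single (Sum.inr i) 1))
    (fun i => -φ (Pi.single (Sum.inl i) 1)), fun v => ?_⟩
  have hv : φ v = ∑ a, φ (Pi.single a (v a)) := by rw [← map_sum, Finset.univ_sum_single]
  have : ∀ a, φ (Pi.single a (v a)) = v a * φ (Pi.single a 1) := fun a => by
    rw [← smul_eq_mul, ← map_smul, ← Pi.single_smul, smul_eq_mul, mul_one]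
  simp only [hv, this, Fintype.sum_sum_type, form_apply, sympForm, Sum.elim_inl, Sum.elim_inr,
    ← Finset.sum_add_distrib]
  exact Finset.sum_congr rfl fun _ _ => by ring

/-- A vector outside a subspace is detected by a vector orthogonal to the subspace. -/
lemma exists_orthogonal (W : Submodule k (Fin n ⊕ Fin n → k)) {a : Fin n ⊕ Fin n → k}
    (ha : a ∉ W) : ∃ z, (∀ w ∈ W, form z w = 0) ∧ form z a ≠ 0 := by
  obtain ⟨φ, hφ, hW⟩ := Submodule.exists_le_ker_of_notMem ha
  obtain ⟨z, hz⟩ := exists_form_eq φ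
  exact ⟨z, fun w hw => (hz w).trans (hW hw), by rwa [hz]⟩

lemma mem_span_singleton_of_form {w y : Fin n ⊕ Fin n → k}
    (h : ∀ z, form z w = 0 → form z y = 0) : ∃ c : k, y = c • w := by
  by_contra hc
  have : y ∉ Submodule.span k {w} := fun hy => by
    obtain ⟨c, hc'⟩ := Submodule.mem_span_singleton.1 hy
    exact hc ⟨c, hc'.symm⟩
  obtain ⟨z, hz, hz'⟩ := exists_orthogonal _ this
  exact hz' (h z (hz w (Submodule.mem_span_singleton_self w)))

lemma eq_zero_of_form {y : Fin n ⊕ Fin n → k} (h : ∀ z, form z y = 0) : y = 0 := by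
  by_contra hy
  obtain ⟨z, -, hz⟩ := exists_orthogonal (⊥ : Submodule k _) (a := y) (by simpa using hy)
  exact hz (h z)

end Symp

end SympCharTwo

namespace SympCharTwo

section LieKolchin

open scoped commutatorElement

lemma IsPreconnected.eq_of_finite_image {X K : Type*} [TopologicalSpace X] {S : Set X}
    (hS : IsPreconnected S) {f : X → K} (hf : ∀ c, IsClosed {x | f x = c})
    (hfin : (f '' S).Finite) {x y : X} (hx : x ∈ S) (hy : y ∈ S) : f x = f y := by
  by_contra hne
  have hB : IsClosed (⋃ c ∈ f '' S \ {f x}, {z | f z = c}) :=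
    (hfin.subset Set.sdiff_subset).isClosed_biUnion fun c _ => hf c
  obtain ⟨z, -, hz, hz'⟩ := isPreconnected_closed_iff.1 hS _ _ (hf (f x)) hB
    (fun z hz => by
      by_cases h : f z = f x
      · exact Or.inl h
      · exact Or.inr (Set.mem_biUnion (x := f z) ⟨⟨z, hz, rfl⟩, h⟩ rfl))
    ⟨x, hx, rfl⟩ ⟨y, hy, Set.mem_biUnion (x := f y) ⟨⟨y, hy, rfl⟩, fun h => hne h.symm⟩ rfl⟩
  obtain ⟨c, hc, hzc⟩ := Set.mem_iUnion₂.1 hz'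
  exact hc.2 (hzc.symm.trans hz)

variable {Γ : Type*} [Group Γ]

lemma isPreconnected_commutator [TopologicalSpace Γ] (hL : ∀ h : Γ, Continuous fun g : Γ => h * g)
    (hC : ∀ h : Γ, Continuous fun g : Γ => ⁅g, h⁆) {S : Subgroup Γ}
    (hS : IsPreconnected (S : Set Γ)) : IsPreconnected ((⁅S, S⁆ : Subgroup Γ) : Set Γ) := by
  refine isPreconnected_of_forall 1 fun y hy => ?_
  rw [SetLike.mem_coe, Subgroup.commutator_def] at hy
  induction hy using Subgroup.closure_induction with
  | mem x hx =>
    obtain ⟨g, hg, h, hh, rfl⟩ := hx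
    refine ⟨(fun g => ⁅g, h⁆) '' S, ?_, ⟨1, S.one_mem, by simp⟩, ⟨g, hg, rfl⟩,
      hS.image _ (hC h).continuousOn⟩
    rintro _ ⟨g', hg', rfl⟩
    exact Subgroup.commutator_mem_commutator hg' hh
  | one => exact ⟨{1}, by simp, rfl, rfl, isPreconnected_singleton⟩
  | mul x y hx hy ihx ihy =>
    obtain ⟨t, ht, ht1, htx, htc⟩ := ihx
    obtain ⟨s, hs, hs1, hsy, hsc⟩ := ihy
    refine ⟨t ∪ (fun g => x * g) '' s, ?_, Or.inl ht1, Or.inr ⟨y, hsy, rfl⟩,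
      IsPreconnected.union x htx ⟨1, hs1, mul_one x⟩ htc (hsc.image _ (hL x).continuousOn)⟩
    rintro z (hz | ⟨z, hz, rfl⟩)
    · exact ht hz
    · exact mul_mem (ht htx) (hs hz)
  | inv x hx ih =>
    obtain ⟨t, ht, ht1, htx, htc⟩ := ih
    refine ⟨(fun g => x⁻¹ * g) '' t, ?_, ⟨x, htx, by simp⟩, ⟨1, ht1, by simp⟩,
      htc.image _ (hL _).continuousOn⟩
    rintro _ ⟨z, hz, rfl⟩
    exact mul_mem (inv_mem (ht htx)) (ht hz)

variable {K M : Type*} [Field K] [AddCommGroup M] [Module K M]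

lemma exists_dual_eq_one {v : M} (hv : v ≠ 0) : ∃ φ : Module.Dual K M, φ v = 1 := by
  obtain ⟨φ, hφ, -⟩ := Submodule.exists_le_ker_of_notMem (p := (⊥ : Submodule K M)) (v := v)
    (by simpa using hv)
  exact ⟨(φ v)⁻¹ • φ, by simp [hφ]⟩

/-- On a submodule stable under `S` the commutator subgroup of `S` acts with determinant one. -/
lemma pow_finrank_eq_one [FiniteDimensional K M] (ρ : Γ →* Module.End K M) {S : Subgroup Γ}
    {N : Submodule K M} (hN : ∀ g ∈ S, ∀ m ∈ N, ρ g m ∈ N) {h : Γ} (hh : h ∈ ⁅S, S⁆) {c : K}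
    (hc : ∀ m ∈ N, ρ h m = c • m) : c ^ Module.finrank K N = 1 := by
  let δ : S →* K :=
    { toFun := fun g => LinearMap.det ((ρ g).restrict (hN g g.2))
      map_one' := by
        rw [← LinearMap.det_id (M := N) (A := K)]
        congr 1
        ext m
        simp
      map_mul' := fun a b => by
        rw [← LinearMap.det_comp]
        congr 1
        ext m
        simp }
  obtain ⟨hS, hδ⟩ : ∃ hS : h ∈ S, δ ⟨h, hS⟩ = 1 := by
    rw [← Subgroup.range_subtype S, MonoidHom.range_eq_map, ← Subgroup.map_commutator] at hh
    obtain ⟨h', hh', rfl⟩ := hh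
    refine ⟨h'.2, ?_⟩
    have := Abelianization.commutator_subset_ker δ.toHomUnits hh'
    exact congrArg Units.val (MonoidHom.mem_ker.1 this)
  have : (ρ h).restrict (hN h hS) = c • LinearMap.id := by
    ext m
    simp [hc m m.2]
  change LinearMap.det ((ρ h).restrict (hN h hS)) = 1 at hδ
  rwa [this, LinearMap.det_smul, LinearMap.det_id, mul_one] at hδ

/-- The Lie–Kolchin theorem for connected solvable groups of operators. -/
lemma exists_common_eigenvector_of_iterate [TopologicalSpace Γ] [IsAlgClosed K]
    [FiniteDimensional K M]
    (hL : ∀ h : Γ, Continuous fun g : Γ => h * g)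
    (hC : ∀ h : Γ, Continuous fun g : Γ => ⁅g, h⁆)
    (hJ : ∀ h : Γ, Continuous fun g : Γ => g⁻¹ * h * g)
    (ρ : Γ →* Module.End K M)
    (hρ : ∀ (φ : Module.Dual K M) v c, IsClosed {g | φ (ρ g v) = c}) (d : ℕ) :
    ∀ S : Subgroup Γ, IsPreconnected (S : Set Γ) → (fun S : Subgroup Γ => ⁅S, S⁆)^[d] S = ⊥ →
      ∀ N : Submodule K M, N ≠ ⊥ → (∀ g ∈ S, ∀ m ∈ N, ρ g m ∈ N) →
      ∃ v ∈ N, v ≠ 0 ∧ ∀ g ∈ S, ∃ c : K, ρ g v = c • v := by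
  induction d with
  | zero =>
    intro S _ hS N hN _
    obtain ⟨v, hv, hv0⟩ := Submodule.exists_mem_ne_zero_of_ne_bot hN
    refine ⟨v, hv, hv0, fun g hg => ⟨1, ?_⟩⟩
    have : g = 1 := by
      rw [Function.iterate_zero, id] at hS
      simpa [hS] using hg
    simp [this]
  | succ d ih =>
    intro S hSc hSd N
    induction N using WellFoundedLT.induction with
    | ind N ihN =>
    intro hN hst
    by_cases hmin : ∃ N' < N, N' ≠ ⊥ ∧ ∀ g ∈ S, ∀ m ∈ N', ρ g m ∈ N'
    · obtain ⟨N', hlt, h0, hst'⟩ := hmin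
      obtain ⟨v, hv, h⟩ := ihN N' hlt h0 hst'
      exact ⟨v, hlt.le hv, h⟩
    have hmin' : ∀ N' ≤ N, N' ≠ ⊥ → (∀ g ∈ S, ∀ m ∈ N', ρ g m ∈ N') → N' = N := by
      intro N' hle h0 hst'
      by_contra hne
      exact hmin ⟨N', lt_of_le_of_ne hle hne, h0, hst'⟩
    have hle : ⁅S, S⁆ ≤ S := Subgroup.commutator_le.2 fun a ha b hb =>
      mul_mem (mul_mem (mul_mem ha hb) (inv_mem ha)) (inv_mem hb)
    have hconn := isPreconnected_commutator hL hC hSc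
    obtain ⟨v, hvN, hv0, hv⟩ := ih ⁅S, S⁆ hconn
      (by rwa [Function.iterate_succ_apply] at hSd) N hN fun g hg => hst g (hle hg)
    obtain ⟨φ, hφ⟩ := exists_dual_eq_one (K := K) hv0
    set χ : Γ → K := fun h => φ (ρ h v) with hχ
    have hvχ : ∀ h ∈ ⁅S, S⁆, ρ h v = χ h • v := by
      intro h hh
      obtain ⟨c, hc⟩ := hv h hh
      rw [hχ]
      simp [hc, hφ]
    have hconj : ∀ g ∈ S, ∀ h ∈ ⁅S, S⁆, g⁻¹ * h * g ∈ ⁅S, S⁆ := by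
      intro g hg h hh
      have : g⁻¹ * h * g = ⁅g⁻¹, h⁆ * h := by simp [commutatorElement_def]
      rw [this]
      exact mul_mem (Subgroup.commutator_mem_commutator (inv_mem hg) (hle hh)) hh
    have hinv : ∀ g ∈ S, ∀ h ∈ ⁅S, S⁆, χ (g⁻¹ * h * g) = χ h := by
      intro g hg h hh
      have hfin : ((fun g => χ (g⁻¹ * h * g)) '' (S : Set Γ)).Finite := by
        refine (Module.End.finite_hasEigenvalue (ρ h)).subset ?_
        rintro _ ⟨g, hg, rfl⟩
        refine Module.End.hasEigenvalue_of_hasEigenvector (x := ρ g v)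
          (Module.End.hasEigenvector_iff.2 ⟨Module.End.mem_eigenspace_iff.2 ?_, fun h0 => hv0 ?_⟩)
        · have h1 := hvχ _ (hconj g hg h hh)
          have h2 : ρ h (ρ g v) = ρ g (ρ (g⁻¹ * h * g) v) := by
            rw [← Module.End.mul_apply, ← Module.End.mul_apply, ← map_mul, ← map_mul]
            congr 2
            group
          rw [h2, h1, map_smul]
        · have : ρ g⁻¹ (ρ g v) = v := by
            rw [← Module.End.mul_apply, ← map_mul]
            simp
          rw [← this, h0, map_zero]
      have := IsPreconnected.eq_of_finite_image hSc
        (f := fun g => χ (g⁻¹ * h * g)) (fun c => (hρ φ v c).preimage (hJ h)) hfin hg S.one_mem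
      simpa using this
    let E : Submodule K M :=
      { carrier := {m | m ∈ N ∧ ∀ h ∈ ⁅S, S⁆, ρ h m = χ h • m}
        add_mem' := fun ha hb => ⟨N.add_mem ha.1 hb.1, fun h hh => by
          rw [map_add, ha.2 h hh, hb.2 h hh, smul_add]⟩
        zero_mem' := ⟨N.zero_mem, fun h _ => by simp⟩
        smul_mem' := fun c m hm => ⟨N.smul_mem c hm.1, fun h hh => by
          rw [map_smul, hm.2 h hh, smul_comm]⟩ }
    have hE : E = N := by
      refine hmin' E (fun m hm => hm.1) (fun h0 => hv0 ?_) ?_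
      · have : v ∈ E := ⟨hvN, hvχ⟩
        rw [h0] at this
        simpa using this
      · intro g hg m hm
        refine ⟨hst g hg m hm.1, fun h hh => ?_⟩
        have h2 : ρ h (ρ g m) = ρ g (ρ (g⁻¹ * h * g) m) := by
          rw [← Module.End.mul_apply, ← Module.End.mul_apply, ← map_mul, ← map_mul]
          congr 2
          group
        rw [h2, hm.2 _ (hconj g hg h hh), hinv g hg h hh, map_smul]
    have hNχ : ∀ m ∈ N, ∀ h ∈ ⁅S, S⁆, ρ h m = χ h • m := fun m hm => by
      rw [← hE] at hm
      exact hm.2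
    have hχ1 : ∀ h ∈ ⁅S, S⁆, χ h = 1 := by
      intro h hh
      have hd : 0 < Module.finrank K N := by
        rw [Nat.pos_iff_ne_zero, ne_eq, Submodule.finrank_eq_zero]
        exact hN
      classical
      have hfin : (χ '' (⁅S, S⁆ : Subgroup Γ)).Finite := by
        refine (Polynomial.nthRoots (Module.finrank K N) (1 : K)).toFinset.finite_toSet.subset ?_
        rintro _ ⟨h, hh, rfl⟩
        simp only [Finset.mem_coe, Multiset.mem_toFinset]
        exact (Polynomial.mem_nthRoots hd).2
          (pow_finrank_eq_one ρ hst hh fun m hm => hNχ m hm h hh)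
      have := IsPreconnected.eq_of_finite_image hconn (f := χ) (hρ φ v) hfin hh (one_mem _)
      rw [this, hχ]
      simp [hφ]
    refine ⟨v, hvN, hv0, fun g hg => ?_⟩
    have : Nontrivial N := Submodule.nontrivial_iff_ne_bot.2 hN
    obtain ⟨μ, hμ⟩ := Module.End.exists_eigenvalue ((ρ g).restrict (hst g hg))
    obtain ⟨w, hw⟩ := hμ.exists_hasEigenvector
    have hw' : ρ g w = μ • (w : M) := by
      have := congrArg Subtype.val hw.apply_eq_smul
      simpa using this
    let E' : Submodule K M := N ⊓ LinearMap.ker (ρ g - μ • LinearMap.id)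
    have hE'm : ∀ m, m ∈ E' ↔ m ∈ N ∧ ρ g m = μ • m := fun m => by
      simp [E', sub_eq_zero]
    have hE' : E' = N := by
      refine hmin' E' inf_le_left (fun h0 => hw.2 ?_) ?_
      · have : (w : M) ∈ E' := (hE'm _).2 ⟨w.2, hw'⟩
        rw [h0] at this
        exact Subtype.ext (by simpa using this)
      · intro s hs m hm
        obtain ⟨hmN, hm⟩ := (hE'm m).1 hm
        refine (hE'm _).2 ⟨hst s hs m hmN, ?_⟩
        have hcm : ⁅g⁻¹, s⁻¹⁆ ∈ ⁅S, S⁆ :=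
          Subgroup.commutator_mem_commutator (inv_mem hg) (inv_mem hs)
        have h2 : ρ g (ρ s m) = ρ s (ρ g (ρ ⁅g⁻¹, s⁻¹⁆ m)) := by
          simp only [← Module.End.mul_apply, ← map_mul]
          congr 2
          rw [commutatorElement_def]
          group
        rw [h2, hNχ m hmN _ hcm, hχ1 _ hcm, one_smul, hm, map_smul]
    have : v ∈ E' := by rwa [hE']
    exact ⟨μ, ((hE'm v).1 this).2⟩

lemma exists_common_eigenvector [TopologicalSpace Γ] [IsAlgClosed K] [FiniteDimensional K M]
    (hL : ∀ h : Γ, Continuous fun g : Γ => h * g)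
    (hC : ∀ h : Γ, Continuous fun g : Γ => ⁅g, h⁆)
    (hJ : ∀ h : Γ, Continuous fun g : Γ => g⁻¹ * h * g)
    (ρ : Γ →* Module.End K M)
    (hρ : ∀ (φ : Module.Dual K M) v c, IsClosed {g | φ (ρ g v) = c})
    (hconn : IsPreconnected (Set.univ : Set Γ)) (hsolv : Group.IsSolvable Γ)
    (N : Submodule K M) (hN : N ≠ ⊥) (hst : ∀ g, ∀ m ∈ N, ρ g m ∈ N) :
    ∃ v ∈ N, v ≠ 0 ∧ ∀ g, ∃ c : K, ρ g v = c • v := by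
  obtain ⟨d, hd⟩ := hsolv
  have key : ∀ d, (fun S : Subgroup Γ => ⁅S, S⁆)^[d] ⊤ = derivedSeries Γ d := by
    intro d
    induction d with
    | zero => rfl
    | succ d ih => rw [Function.iterate_succ_apply', ih, derivedSeries_succ]
  obtain ⟨v, hv, hv0, h⟩ := exists_common_eigenvector_of_iterate hL hC hJ ρ hρ d ⊤
    (by simpa using hconn) ((key d).trans hd) N hN fun g _ => hst g
  exact ⟨v, hv, hv0, fun g => h g trivial⟩

end LieKolchin

end SympCharTwo

namespace SympCharTwo

section RelativeLieKolchin

open scoped commutatorElement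

variable {k n}

/-- A connected solvable subgroup stabilising `W < N` has an eigenvector in `N / W`. -/
lemma exists_relative_eigenvector [IsAlgClosed k] {B : Subgroup (SpGroup k n)}
    (hB : IsPreconnected (B : Set (SpGroup k n))) (hs : Group.IsSolvable B)
    {W N : Submodule k (Fin n ⊕ Fin n → k)} (hW : ∀ g ∈ B, ∀ v ∈ W, mat g *ᵥ v ∈ W)
    (hN : ∀ g ∈ B, ∀ v ∈ N, mat g *ᵥ v ∈ N) (hlt : W < N) :
    ∃ v ∈ N, v ∉ W ∧ ∀ g ∈ B, ∃ c : k, mat g *ᵥ v - c • v ∈ W := by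
  let ρ : B →* Module.End k ((Fin n ⊕ Fin n → k) ⧸ W) :=
    { toFun := fun g => W.mapQ W (Matrix.mulVecLin (mat g.1)) (hW g.1 g.2)
      map_one' := by
        refine Submodule.linearMap_qext _ (LinearMap.ext fun v => ?_)
        simp
      map_mul' := fun a b => by
        refine Submodule.linearMap_qext _ (LinearMap.ext fun v => ?_)
        change W.mkQ (mat (a.1 * b.1) *ᵥ v) = W.mkQ (mat a.1 *ᵥ (mat b.1 *ᵥ v))
        rw [mat_mul, Matrix.mulVec_mulVec] }
  have hρm : ∀ (g : B) v, ρ g (W.mkQ v) = W.mkQ (mat g.1 *ᵥ v) := fun g v => rfl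
  have hcont : ∀ {f : SpGroup k n → SpGroup k n} (hf : IsRegMap f) {f' : B → B},
      (∀ g, (f' g : SpGroup k n) = f g) → Continuous f' := by
    intro f hf f' h
    refine continuous_induced_rng.2 ?_
    have : Subtype.val ∘ f' = f ∘ Subtype.val := funext h
    rw [this]
    exact hf.continuous.comp continuous_subtype_val
  have hρ : ∀ (φ : Module.Dual k ((Fin n ⊕ Fin n → k) ⧸ W)) v c, IsClosed {g | φ (ρ g v) = c} := by
    intro φ v c
    obtain ⟨v, rfl⟩ := W.mkQ_surjective v
    obtain ⟨z, hz⟩ := exists_form_eq (φ ∘ₗ W.mkQ)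
    have h := isClosed_eq_zero ((isReg_sympForm z v isRegMap_id).sub (IsReg.const c))
    convert h.preimage (continuous_subtype_val (p := fun g => g ∈ B)) using 1
    ext g
    have := hz (mat g.1 *ᵥ v)
    simp only [LinearMap.comp_apply, form_apply] at this
    rw [Set.mem_ofPred_eq, Set.mem_preimage, Set.mem_ofPred_eq, hρm, ← this, sub_eq_zero]
  obtain ⟨v, hv, hv0, h⟩ := exists_common_eigenvector (Γ := B)
    (fun h => hcont ((IsRegMap.const h.1).mul isRegMap_id) fun g => rfl)
    (fun h => hcont ((((isRegMap_id).mul (IsRegMap.const h.1)).mul isRegMap_inv).mul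
      (IsRegMap.const (h.1)⁻¹)) fun g => rfl)
    (fun h => hcont ((isRegMap_inv.mul (IsRegMap.const h.1)).mul isRegMap_id) fun g => rfl)
    ρ hρ (Subtype.preconnectedSpace hB).isPreconnected_univ hs (N.map W.mkQ)
    (fun h => hlt.not_ge (by
      have := LinearMap.le_ker_iff_map.2 h
      rwa [Submodule.ker_mkQ] at this))
    (by
      rintro g _ ⟨m, hm, rfl⟩
      exact ⟨_, hN g.1 g.2 m hm, rfl⟩)
  obtain ⟨v, hvN, rfl⟩ := hv
  refine ⟨v, hvN, fun hvW => hv0 (by simpa using hvW), fun g hg => ?_⟩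
  obtain ⟨c, hc⟩ := h ⟨g, hg⟩
  refine ⟨c, ?_⟩
  rw [hρm, ← map_smul, ← sub_eq_zero, ← map_sub] at hc
  exact (Submodule.Quotient.mk_eq_zero W).1 hc

end RelativeLieKolchin

end SympCharTwo

namespace SympCharTwo

section Curves

open Polynomial

variable {k n}

/-- The function `f` agrees with a quotient `P / d ^ m` away from the zeros of `d`. -/
def IsRat (d : k[X]) (f : k → k) : Prop :=
  ∃ (m : ℕ) (P : k[X]), ∀ s, d.eval s ≠ 0 → f s * d.eval s ^ m = P.eval s

lemma IsRat.const (d : k[X]) (c : k) : IsRat d fun _ => c := ⟨0, C c, fun s _ => by simp⟩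

lemma IsRat.id (d : k[X]) : IsRat d fun s => s := ⟨0, X, fun s _ => by simp⟩

lemma IsRat.add {d : k[X]} {f f' : k → k} (h : IsRat d f) (h' : IsRat d f') :
    IsRat d fun s => f s + f' s := by
  obtain ⟨m, P, hP⟩ := h
  obtain ⟨m', P', hP'⟩ := h'
  refine ⟨m + m', P * d ^ m' + P' * d ^ m, fun s hs => ?_⟩
  simp only [eval_add, eval_mul, eval_pow, ← hP s hs, ← hP' s hs]
  ring

lemma IsRat.mul {d : k[X]} {f f' : k → k} (h : IsRat d f) (h' : IsRat d f') :
    IsRat d fun s => f s * f' s := by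
  obtain ⟨m, P, hP⟩ := h
  obtain ⟨m', P', hP'⟩ := h'
  refine ⟨m + m', P * P', fun s hs => ?_⟩
  simp only [eval_mul, ← hP s hs, ← hP' s hs]
  ring

lemma IsRat.neg {d : k[X]} {f : k → k} (h : IsRat d f) : IsRat d fun s => -f s := by
  simpa using (IsRat.const d (-1)).mul h

lemma IsRat.sum {d : k[X]} {ι : Type*} (t : Finset ι) {f : ι → k → k}
    (h : ∀ i ∈ t, IsRat d (f i)) : IsRat d fun s => ∑ i ∈ t, f i s := by
  classical
  induction t using Finset.induction_on with
  | empty => simpa using IsRat.const d 0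
  | insert a t ha ih =>
    simp only [Finset.sum_insert ha]
    exact (h a (by simp)).add (ih fun i hi => h i (by simp [hi]))

lemma IsRat.prod {d : k[X]} {ι : Type*} (t : Finset ι) {f : ι → k → k}
    (h : ∀ i ∈ t, IsRat d (f i)) : IsRat d fun s => ∏ i ∈ t, f i s := by
  classical
  induction t using Finset.induction_on with
  | empty => simpa using IsRat.const d 1
  | insert a t ha ih =>
    simp only [Finset.prod_insert ha]
    exact (h a (by simp)).mul (ih fun i hi => h i (by simp [hi]))

lemma IsRat.exists_eval {f : k → k} (h : IsRat 1 f) : ∃ P : k[X], ∀ s, f s = P.eval s := by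
  obtain ⟨m, P, hP⟩ := h
  exact ⟨P, fun s => by simpa using hP s (by simp)⟩

/-- Determinants of matrices with rational entries are rational. -/
lemma IsRat.det {d : k[X]} {ι : Type*} [Fintype ι] [DecidableEq ι] {A : k → Matrix ι ι k}
    (h : ∀ a b, IsRat d fun s => A s a b) : IsRat d fun s => (A s).det := by
  simp only [Matrix.det_apply']
  exact IsRat.sum _ fun σ _ => (IsRat.const d _).mul (IsRat.prod _ fun i _ => h _ _)

/-- A curve in the symplectic group defined away from the zeros of `d`. -/
def IsCurve (d : k[X]) (φ : k → SpGroup k n) : Prop := ∀ a b, IsRat d fun s => mat (φ s) a b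

lemma IsCurve.const (d : k[X]) (g : SpGroup k n) : IsCurve d fun _ => g :=
  fun _ _ => IsRat.const d _

lemma IsCurve.mul {d : k[X]} {φ ψ : k → SpGroup k n} (h : IsCurve d φ) (h' : IsCurve d ψ) :
    IsCurve d fun s => φ s * ψ s := by
  intro a b
  simp only [mat_mul, Matrix.mul_apply]
  exact IsRat.sum _ fun i _ => (h a i).mul (h' i b)

lemma IsCurve.inv {d : k[X]} {φ : k → SpGroup k n} (h : IsCurve d φ) :
    IsCurve d fun s => (φ s)⁻¹ := by
  intro a b
  simp only [mat_inv, Matrix.neg_apply, Matrix.mul_apply, Matrix.transpose_apply]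
  exact (IsRat.sum _ fun j _ => (IsRat.sum _ fun i _ =>
    (IsRat.const d _).mul (h _ _)).mul (IsRat.const d _)).neg

lemma IsReg.isRat {F : SpGroup k n → k} (hF : IsReg F) {d : k[X]} {φ : k → SpGroup k n}
    (h : IsCurve d φ) : IsRat d fun s => F (φ s) := by
  obtain ⟨p, hp⟩ := hF
  simp only [hp]
  induction p using MvPolynomial.induction_on generalizing F with
  | C c => simpa using IsRat.const d c
  | add p q ih ih' =>
    simp only [map_add]
    exact (ih fun _ => rfl).add (ih' fun _ => rfl)
  | mul_X p i ih =>
    simp only [map_mul, MvPolynomial.eval_X]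
    refine (ih fun _ => rfl).mul ?_
    rcases i with ⟨a, b⟩ | ⟨a, b⟩
    · exact h a b
    · exact h.inv a b

lemma exists_eval_ne_zero [Infinite k] {P : k[X]} (hP : P ≠ 0) : ∃ s, P.eval s ≠ 0 := by
  by_contra! h
  exact hP (Polynomial.funext fun s => by simp [h s])

/-- A curve lying generically in a closed set lies in it. -/
lemma IsCurve.mem_of_isClosed [Infinite k] {d : k[X]} {φ : k → SpGroup k n} (h : IsCurve d φ)
    {Z : Set (SpGroup k n)} (hZ : IsClosed Z) {e : k[X]} (he : e ≠ 0)
    (hφ : ∀ s, d.eval s ≠ 0 → e.eval s ≠ 0 → φ s ∈ Z) {s : k} (hs : d.eval s ≠ 0) : φ s ∈ Z := by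
  by_contra hn
  obtain ⟨F, hF, hFs, hFZ⟩ := exists_isReg_of_isOpen hZ.isOpen_compl hn
  obtain ⟨m, P, hP⟩ := hF.isRat h
  have hP0 : P ≠ 0 := by
    rintro rfl
    have := hP s hs
    simp [hFs, hs] at this
  have hd0 : d ≠ 0 := by
    rintro rfl
    simp at hs
  obtain ⟨t, ht⟩ := exists_eval_ne_zero (mul_ne_zero (mul_ne_zero hP0 he) hd0)
  simp only [eval_mul, ne_eq, mul_eq_zero, not_or] at ht
  refine hFZ (φ t) (fun h0 => ht.1.1 ?_) (hφ t ht.2 ht.1.2)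
  simp [← hP t ht.2, h0]

lemma IsCurve.isPreconnected_image [Infinite k] {d : k[X]} {φ : k → SpGroup k n}
    (h : IsCurve d φ) : IsPreconnected (φ '' {s | d.eval s ≠ 0}) := by
  refine IsPreirreducible.isPreconnected ?_
  rintro U V hU hV ⟨_, ⟨s, hs, rfl⟩, hsU⟩ ⟨_, ⟨t, ht, rfl⟩, htV⟩
  rw [Set.mem_ofPred_eq] at hs ht
  obtain ⟨F, hF, hFs, hFU⟩ := exists_isReg_of_isOpen hU hsU
  obtain ⟨F', hF', hFt, hFV⟩ := exists_isReg_of_isOpen hV htV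
  obtain ⟨m, P, hP⟩ := hF.isRat h
  obtain ⟨m', P', hP'⟩ := hF'.isRat h
  have hP0 : P ≠ 0 := by
    rintro rfl
    have := hP s hs
    simp [hFs, hs] at this
  have hP0' : P' ≠ 0 := by
    rintro rfl
    have := hP' t ht
    simp [hFt, ht] at this
  have hd0 : d ≠ 0 := by
    rintro rfl
    simp at hs
  obtain ⟨r, hr⟩ := exists_eval_ne_zero (mul_ne_zero (mul_ne_zero hP0 hP0') hd0)
  simp only [eval_mul, ne_eq, mul_eq_zero, not_or] at hr
  refine ⟨φ r, ⟨r, hr.2, rfl⟩, hFU _ fun h0 => hr.1.1 ?_, hFV _ fun h0 => hr.1.2 ?_⟩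
  · simp [← hP r hr.2, h0]
  · simp [← hP' r hr.2, h0]

/-- The element `g` is joined to the identity by a polynomial curve. -/
def IsJoined (g : SpGroup k n) : Prop :=
  ∃ φ : k → SpGroup k n, IsCurve 1 φ ∧ φ 0 = 1 ∧ φ 1 = g

lemma IsJoined.one : IsJoined (1 : SpGroup k n) := ⟨_, IsCurve.const 1 1, rfl, rfl⟩

lemma IsJoined.mul {g h : SpGroup k n} (hg : IsJoined g) (hh : IsJoined h) :
    IsJoined (g * h) := by
  obtain ⟨φ, hφ, h0, h1⟩ := hg
  obtain ⟨ψ, hψ, h0', h1'⟩ := hh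
  exact ⟨_, hφ.mul hψ, by simp [h0, h0'], by simp [h1, h1']⟩

end Curves

section Witt

variable {k n}

/-- The element of the symplectic group given by a linear map preserving the form. -/
def ofLin (f : (Fin n ⊕ Fin n → k) →ₗ[k] (Fin n ⊕ Fin n → k))
    (hf : ∀ v w, form (f v) (f w) = form v w) : SpGroup k n :=
  mk (LinearMap.toMatrix' f) fun v w => by
    rw [LinearMap.toMatrix'_mulVec, LinearMap.toMatrix'_mulVec]
    exact hf v w

lemma mat_ofLin_mulVec (f : (Fin n ⊕ Fin n → k) →ₗ[k] (Fin n ⊕ Fin n → k)) (hf)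
    (v : Fin n ⊕ Fin n → k) : mat (ofLin f hf) *ᵥ v = f v :=
  LinearMap.toMatrix'_mulVec f v

/-- The symplectic transvection `x ↦ x + c ⟨x, a⟩ a`. -/
def transv (a : Fin n ⊕ Fin n → k) (c : k) : SpGroup k n :=
  ofLin (LinearMap.id + c • (form.flip a).smulRight a) fun v w => by
    simp only [LinearMap.add_apply, LinearMap.id_apply, LinearMap.smul_apply,
      LinearMap.smulRight_apply, LinearMap.flip_apply, map_add, map_smul, smul_eq_mul, form_self,
      form_neg_comm a w]
    ring

lemma transv_mulVec (a : Fin n ⊕ Fin n → k) (c : k) (x : Fin n ⊕ Fin n → k) :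
    mat (transv a c) *ᵥ x = x + (c * form x a) • a := by
  rw [transv, mat_ofLin_mulVec]
  simp [smul_smul]

lemma isJoined_transv (a : Fin n ⊕ Fin n → k) (c : k) : IsJoined (transv a c) := by
  have key : ∀ (s : k) i j, mat (transv a (s * c)) i j =
      (Pi.single j 1 : Fin n ⊕ Fin n → k) i + s * (c * form (Pi.single j 1) a * a i) := by
    intro s i j
    have := congrFun (transv_mulVec a (s * c) (Pi.single j 1)) i
    rw [Matrix.mulVec_single_one, Matrix.col_apply] at this
    rw [this]
    simp only [Pi.add_apply, Pi.smul_apply, smul_eq_mul]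
    ring
  refine ⟨fun s => transv a (s * c), fun i j => ?_, ?_, by simp⟩
  · simp only [key]
    exact (IsRat.const _ _).add ((IsRat.id _).mul (IsRat.const _ _))
  · refine mat_injective ?_
    ext i j
    rw [key]
    simp [Matrix.one_apply, Pi.single_apply]

lemma exists_transv_of_form_ne_zero {W : Submodule k (Fin n ⊕ Fin n → k)}
    {w w' : Fin n ⊕ Fin n → k} (hw : ∀ x ∈ W, form x w = 0) (hw' : ∀ x ∈ W, form x w' = 0)
    (h : form w w' ≠ 0) :
    ∃ g : SpGroup k n, IsJoined g ∧ (∀ x ∈ W, mat g *ᵥ x = x) ∧ mat g *ᵥ w = w' := by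
  refine ⟨transv (w' - w) (form w w')⁻¹, isJoined_transv _ _, fun x hx => ?_, ?_⟩
  · rw [transv_mulVec]
    simp [hw x hx, hw' x hx]
  · rw [transv_mulVec]
    simp [form_self, h]

/-- Witt's extension step for a single vector orthogonal to a fixed subspace. -/
lemma exists_fixing_mulVec_eq {W : Submodule k (Fin n ⊕ Fin n → k)}
    {w w' : Fin n ⊕ Fin n → k} (hw : ∀ x ∈ W, form x w = 0) (hw' : ∀ x ∈ W, form x w' = 0)
    (hwW : w ∉ W) (hwW' : w' ∉ W) :
    ∃ g : SpGroup k n, IsJoined g ∧ (∀ x ∈ W, mat g *ᵥ x = x) ∧ mat g *ᵥ w = w' := by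
  have hz : ∃ z, (∀ x ∈ W, form x z = 0) ∧ form w z ≠ 0 ∧ form z w' ≠ 0 := by
    obtain ⟨z₁, h₁, h₁'⟩ := exists_orthogonal W hwW
    obtain ⟨z₂, h₂, h₂'⟩ := exists_orthogonal W hwW'
    have h₁W : ∀ x ∈ W, form x z₁ = 0 := fun x hx => by rw [form_neg_comm, h₁ x hx, neg_zero]
    have h₂W : ∀ x ∈ W, form x z₂ = 0 := fun x hx => by rw [form_neg_comm, h₂ x hx, neg_zero]
    rw [form_neg_comm, neg_ne_zero] at h₁'
    by_cases h : form z₁ w' = 0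
    · by_cases h' : form w z₂ = 0
      · refine ⟨z₁ + z₂, fun x hx => ?_, ?_, ?_⟩
        · simp [h₁W x hx, h₂W x hx]
        · simpa [h'] using h₁'
        · simpa [h] using h₂'
      · exact ⟨z₂, h₂W, h', h₂'⟩
    · exact ⟨z₁, h₁W, h₁', h⟩
  obtain ⟨z, hzW, h, h'⟩ := hz
  obtain ⟨g₁, hg₁, hW₁, hw₁⟩ := exists_transv_of_form_ne_zero hw hzW h
  obtain ⟨g₂, hg₂, hW₂, hw₂⟩ := exists_transv_of_form_ne_zero hzW hw' h'
  refine ⟨g₂ * g₁, hg₂.mul hg₁, fun x hx => ?_, ?_⟩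
  · rw [mat_mul, ← Matrix.mulVec_mulVec, hW₁ x hx, hW₂ x hx]
  · rw [mat_mul, ← Matrix.mulVec_mulVec, hw₁, hw₂]

lemma linearIndependent_mat_mulVec (g : SpGroup k n) {ι : Type*} {v : ι → Fin n ⊕ Fin n → k}
    (hv : LinearIndependent k v) : LinearIndependent k fun i => mat g *ᵥ v i := by
  refine hv.map' (Matrix.mulVecLin (mat g)) (LinearMap.ker_eq_bot'.2 fun x hx => ?_)
  have : mat g *ᵥ x = 0 := hx
  rw [← Matrix.one_mulVec x, ← mat_inv_mul g, ← Matrix.mulVec_mulVec, this, Matrix.mulVec_zero]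

/-- Witt's theorem for isotropic families. -/
lemma exists_isJoined_mulVec_eq (r : ℕ) (v v' : Fin r → Fin n ⊕ Fin n → k)
    (hv : LinearIndependent k v) (hv' : LinearIndependent k v')
    (hi : ∀ i j, form (v i) (v j) = 0) (hi' : ∀ i j, form (v' i) (v' j) = 0) :
    ∃ g : SpGroup k n, IsJoined g ∧ ∀ i, mat g *ᵥ v i = v' i := by
  induction r with
  | zero => exact ⟨1, IsJoined.one, fun i => i.elim0⟩
  | succ r ih =>
    obtain ⟨hv₁, -⟩ := linearIndependent_finSucc'.1 hv
    obtain ⟨hv₁', hl'⟩ := linearIndependent_finSucc'.1 hv'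
    obtain ⟨g, hg, hgv⟩ := ih (Fin.init v) (Fin.init v') hv₁ hv₁'
      (fun i j => hi _ _) (fun i j => hi' _ _)
    obtain ⟨-, hl⟩ := linearIndependent_finSucc'.1 (linearIndependent_mat_mulVec g hv)
    have he : (Fin.init fun i => mat g *ᵥ v i) = Fin.init v' := funext hgv
    rw [he] at hl
    obtain ⟨h, hh, hhW, hhw⟩ := exists_fixing_mulVec_eq
      (W := Submodule.span k (Set.range (Fin.init v'))) (w := mat g *ᵥ v (Fin.last r))
      (w' := v' (Fin.last r)) (fun x hx => by
        induction hx using Submodule.span_induction with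
        | mem x hx =>
          obtain ⟨i, rfl⟩ := hx
          rw [← hgv, form_mat]
          exact hi _ _
        | zero => simp
        | add x y _ _ hx hy => simp [hx, hy]
        | smul c x _ hx => simp [hx])
      (fun x hx => by
        induction hx using Submodule.span_induction with
        | mem x hx =>
          obtain ⟨i, rfl⟩ := hx
          exact hi' _ _
        | zero => simp
        | add x y _ _ hx hy => simp [hx, hy]
        | smul c x _ hx => simp [hx]) hl hl'
    refine ⟨h * g, hh.mul hg, fun i => ?_⟩
    rw [mat_mul, ← Matrix.mulVec_mulVec]
    induction i using Fin.lastCases with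
    | last => exact hhw
    | cast i =>
      have := hgv i
      rw [Fin.init] at this
      rw [this]
      exact hhW _ (Submodule.subset_span ⟨i, rfl⟩)

end Witt

end SympCharTwo

namespace SympCharTwo

section Nilpotent

variable {K V : Type*} [Field K] [AddCommGroup V] [Module K V]

lemma eq_zero_of_eq_mul_isNilpotent {R : Type*} [Semiring R] {a x : R} (hx : IsNilpotent x)
    (h : a = a * x) : a = 0 := by
  obtain ⟨m, hm⟩ := hx
  have : ∀ m : ℕ, a = a * x ^ m := fun m => by
    induction m with
    | zero => simp
    | succ m ih => rw [pow_succ', ← mul_assoc, ← h, ← ih]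
  rw [this m, hm, mul_zero]

lemma apply_eq_zero_of_eq_smul {X : Module.End K V} (hX : IsNilpotent X) {w : V} {c : K}
    (h : X w = c • w) : X w = 0 := by
  obtain ⟨m, hm⟩ := hX
  have : ∀ m : ℕ, (X ^ m) w = c ^ m • w := fun m => by
    induction m with
    | zero => simp
    | succ m ih => rw [pow_succ', Module.End.mul_apply, ih, map_smul, h, smul_smul, pow_succ]
  have h0 := this m
  rw [hm, LinearMap.zero_apply, eq_comm, smul_eq_zero] at h0
  rcases h0 with h0 | h0
  · rw [h, eq_zero_of_pow_eq_zero h0, zero_smul]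
  · rw [h0, map_zero]

/-- If a product of two linear functionals vanishes on a subspace, one of them does. -/
lemma forall_eq_zero_or_of_mul {W : Submodule K V} {φ ψ : V →ₗ[K] K}
    (h : ∀ v ∈ W, φ v * ψ v = 0) : (∀ v ∈ W, φ v = 0) ∨ ∀ v ∈ W, ψ v = 0 := by
  by_contra! hc
  obtain ⟨⟨v, hv, hφ⟩, w, hw, hψ⟩ := hc
  have h1 := (mul_eq_zero.1 (h v hv)).resolve_left hφ
  have h2 := (mul_eq_zero.1 (h w hw)).resolve_right hψ
  have h3 := h (v + w) (W.add_mem hv hw)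
  simp [h1, h2, hφ, hψ] at h3

end Nilpotent

section CharTwo

variable {k n}

lemma sq_eq_zero_of_forall_orthogonal {N : Module.End k (Fin n ⊕ Fin n → k)}
    (hnil : IsNilpotent N)
    (h : ∀ v w, form v w = 0 → form v (N (N w)) = 0) (v : Fin n ⊕ Fin n → k) :
    N (N v) = 0 := by
  obtain ⟨c, hc⟩ := mem_span_singleton_of_form fun z hz => h z v hz
  exact apply_eq_zero_of_eq_smul (X := N * N) ((Commute.refl N).isNilpotent_mul_left hnil) hc

variable [CharP k 2]

lemma vec_add_self (v : Fin n ⊕ Fin n → k) : v + v = 0 :=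
  funext fun _ => CharTwo.add_self_eq_zero _

lemma form_comm (v w : Fin n ⊕ Fin n → k) : form v w = form w v := by
  rw [form_neg_comm, CharTwo.neg_eq]

variable {T T' N : Module.End k (Fin n ⊕ Fin n → k)}

lemma form_apply_right (hTT' : ∀ v, T (T' v) = v) (hω : ∀ v w, form (T v) (T w) = form v w)
    (v w : Fin n ⊕ Fin n → k) : form v (T w) = form w (T' v) := by
  rw [form_comm w, ← hω (T' v) w, hTT']

lemma apply_apply_eq (hN : ∀ v, T v = v + N v) (v : Fin n ⊕ Fin n → k) :
    T (T v) = v + N (N v) := by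
  rw [hN, hN, map_add]
  linear_combination (norm := module) vec_add_self (N v)

/-- If `⟨v, T v⟩` vanishes identically, then `T` is an involution. -/
lemma sq_eq_zero_of_form_apply_self (hTT' : ∀ v, T (T' v) = v)
    (hω : ∀ v w, form (T v) (T w) = form v w) (hN : ∀ v, T v = v + N v)
    (h : ∀ v, form v (T v) = 0) (v : Fin n ⊕ Fin n → k) : N (N v) = 0 := by
  have h1 : T v = T' v := by
    rw [← sub_eq_zero]
    refine eq_zero_of_form fun z => ?_
    have h2 := h (z + v)
    simp only [map_add, LinearMap.add_apply, h, form_apply_right hTT' hω v z] at h2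
    rw [map_sub, CharTwo.sub_eq_add]
    simpa [add_comm] using h2
  have h2 := apply_apply_eq hN v
  rw [h1, hTT'] at h2
  simpa using h2.symm

/-- If `⟨v, T² v⟩` is a multiple of `⟨v, T v⟩`, then either `T² = 1`, or `T⁴ = 1` and
`⟨v, T² v⟩` vanishes. -/
lemma sq_eq_zero_or_of_form_sq (hTT' : ∀ v, T (T' v) = v) (hT'T : ∀ v, T' (T v) = v)
    (hω : ∀ v w, form (T v) (T w) = form v w) (hN : ∀ v, T v = v + N v) (hnil : IsNilpotent N)
    {c : k} (h : ∀ v, form v (T (T v)) = c * form v (T v)) :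
    (∀ v, N (N v) = 0) ∨ (∀ v, form v (T (T v)) = 0) ∧ ∀ v, N (N (N (N v))) = 0 := by
  have hpol : ∀ v, T (T v) + T' (T' v) = c • (T v + T' v) := by
    intro v
    rw [← sub_eq_zero]
    refine eq_zero_of_form fun z => ?_
    have h2 := h (z + v)
    simp only [map_add, LinearMap.add_apply, h z, h v] at h2
    rw [form_apply_right hTT' hω v (T z), form_comm (T z), form_apply_right hTT' hω (T' v) z,
      form_apply_right hTT' hω v z] at h2
    simp only [map_add, map_sub, map_smul, smul_eq_mul]
    linear_combination h2
  have h4 : ∀ v, N (N (N (N v))) = c • T (N (N v)) := by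
    intro v
    have h1 := congrArg (fun w => T (T w)) (hpol v)
    simp only [map_add, map_smul, hTT'] at h1
    have e := apply_apply_eq hN
    simp only [e, map_add] at h1
    linear_combination (norm := module) h1 - vec_add_self v - vec_add_self (N (N v)) +
      c • vec_add_self (T v)
  by_cases hc : c = 0
  · subst hc
    exact Or.inr ⟨fun v => by simpa using h v, fun v => by simpa using h4 v⟩
  · left
    have hcomm : Commute (c⁻¹ • T') (N * N) := by
      have : T' * N = N * T' := by
        refine LinearMap.ext fun v => ?_
        have h1 : N v = T v - v := by rw [hN]; abel
        have h2 : N (T' v) = T (T' v) - T' v := by rw [hN (T' v)]; abel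
        rw [Module.End.mul_apply, Module.End.mul_apply, h1, h2, map_sub, hTT', hT'T]
      exact ((Commute.mul_right this this : Commute T' (N * N)).smul_left _)
    have hz : N * N = 0 := by
      refine eq_zero_of_eq_mul_isNilpotent (x := c⁻¹ • T' * (N * N))
        (hcomm.isNilpotent_mul_left ?_) ?_
      · exact (Commute.refl N).isNilpotent_mul_left hnil
      · rw [← mul_assoc, ← hcomm.eq, mul_assoc]
        refine LinearMap.ext fun v => ?_
        simp [h4, hT'T, hc]
    intro v
    exact congrArg (fun X : Module.End k _ => X v) hz

lemma cube_eq_zero_of_form (hTT' : ∀ v, T (T' v) = v) (hT'T : ∀ v, T' (T v) = v)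
    (hN : ∀ v, T v = v + N v) (hnil : IsNilpotent N) {c : k}
    (h : ∀ v w, form v w = 0 →
      form v (N (N w)) * form v (T w + T' w) = c * form v (N (N w)) ^ 2) :
    ∀ v, N (N (N v)) = 0 := by
  have hNN : IsNilpotent (N * N) := (Commute.refl N).isNilpotent_mul_left hnil
  have hsum : ∀ w, T w + T' w = T' (N (N w)) := fun w => by
    have := congrArg T' (apply_apply_eq hN w)
    rw [hT'T, map_add] at this
    linear_combination (norm := module) this + vec_add_self (T' w)
  have hTN : ∀ v, T (N v) = N (T v) := fun v => by rw [hN, hN, map_add]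
  have hT'N : ∀ v, T' (N v) = N (T' v) := fun v => by
    rw [← hT'T (N (T' v)), hTN, hTT']
  let Y : Module.End k (Fin n ⊕ Fin n → k) := (T' - c • 1) * (N * N)
  have hYnil : IsNilpotent Y := by
    have hcomm : Commute (T' - c • 1) (N * N) := by
      have : Commute T' N := LinearMap.ext hT'N
      exact (this.mul_right this).sub_left ((Commute.one_left _).smul_left _)
    exact hcomm.isNilpotent_mul_left hNN
  have hY : ∀ w, Y w = T' (N (N w)) - c • N (N w) := fun w => by simp [Y]
  have hY0 : ∀ w, Y w = 0 := by
    intro w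
    have hprod : ∀ v ∈ LinearMap.ker (form w), form.flip (N (N w)) v * form.flip (Y w) v = 0 := by
      intro v hv
      have := h v w (by rw [form_comm]; exact hv)
      rw [hsum] at this
      simp only [LinearMap.flip_apply, hY]
      rw [map_sub, map_smul, smul_eq_mul]
      linear_combination this
    rcases forall_eq_zero_or_of_mul hprod with h1 | h1
    · obtain ⟨a, ha⟩ := mem_span_singleton_of_form fun z hz =>
        h1 z (by rw [LinearMap.mem_ker, form_comm]; exact hz)
      have : N (N w) = 0 := apply_eq_zero_of_eq_smul hNN ha
      rw [hY, this]
      simp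
    · obtain ⟨a, ha⟩ := mem_span_singleton_of_form fun z hz =>
        h1 z (by rw [LinearMap.mem_ker, form_comm]; exact hz)
      exact apply_eq_zero_of_eq_smul hYnil ha
  have hcN : ∀ w, N (N w) = c • N (N w) + c • N (N (N w)) := by
    intro w
    have h1 := congrArg T (hY0 w)
    rw [hY, map_sub, map_smul, hTT', map_zero, hN (N (N w))] at h1
    linear_combination (norm := module) h1
  intro v
  by_cases hc : c = 1
  · have := hcN v
    simpa [hc] using this
  · have hc' : 1 - c ≠ 0 := sub_ne_zero.2 (Ne.symm hc)
    have hz : N * N = 0 := by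
      refine eq_zero_of_eq_mul_isNilpotent (x := ((1 - c)⁻¹ * c) • N) ?_ ?_
      · exact hnil.smul _
      · refine LinearMap.ext fun w => ?_
        have h1 : (1 - c) • N (N w) = c • N (N (N w)) := by
          linear_combination (norm := module) hcN w
        have h2 : N (N w) = (1 - c)⁻¹ • (1 - c) • N (N w) := by
          rw [smul_smul, inv_mul_cancel₀ hc', one_smul]
        simp only [Module.End.mul_apply, LinearMap.smul_apply, map_smul]
        conv_lhs => rw [h2, h1, smul_smul]
    have := congrArg (fun X : Module.End k _ => X v) hz
    simp only [Module.End.mul_apply, LinearMap.zero_apply] at this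
    rw [this, map_zero]

lemma sq_eq_zero_of_cube_eq_zero (hTT' : ∀ v, T (T' v) = v) (hT'T : ∀ v, T' (T v) = v)
    (hω : ∀ v w, form (T v) (T w) = form v w) (hN : ∀ v, T v = v + N v)
    (hnil : IsNilpotent N) (h3 : ∀ v, N (N (N v)) = 0)
    (h : ∀ v w, form v w = 0 → form v (N (N w)) = 0 →
      form v (T v) * form w (T w) = form v (T w) * form w (T v)) :
    ∀ v, N (N v) = 0 := by
  by_contra! hne
  have hT' : ∀ w, T' w = w + N w + N (N w) := by
    intro w
    have : T (w + N w + N (N w)) = w := by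
      simp only [hN, map_add, h3]
      linear_combination (norm := module) vec_add_self (N w) + vec_add_self (N (N w))
    rw [← hT'T (w + N w + N (N w)), this]
  have hself : ∀ a b, form (N (N a)) b = form a (N (N b)) := by
    intro a b
    have e1 : N (N a) = T (T a) - a := by rw [apply_apply_eq hN]; abel
    have e2 : N (N b) = T' (T' b) - b := by
      simp only [hT', map_add, h3, map_zero]
      linear_combination (norm := module) -vec_add_self (N b) - vec_add_self (N (N b))
    rw [e1, e2, map_sub, map_sub, LinearMap.sub_apply, form_comm (T (T a)),
      form_apply_right hTT' hω, form_comm (T a), form_apply_right hTT' hω]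
  have key : ∀ w, N (N w) = 0 → N w = 0 := by
    intro w hw
    have h1 : ∀ v, form v w = 0 → form v (T v) * form w (T w) = form v (N w) ^ 2 := by
      intro v hv
      rw [h v w hv (by rw [hw, map_zero]), form_apply_right hTT' hω w v, hT', hw, hN w]
      simp only [map_add, hv, map_zero]
      ring
    by_cases hq : form w (T w) = 0
    · obtain ⟨c, hc⟩ := mem_span_singleton_of_form (w := w) (y := N w) fun z hz => by
        simpa [hq] using (h1 z hz).symm
      exact apply_eq_zero_of_eq_smul hnil hc
    · have hNw : N w ≠ 0 := fun h0 => hq (by rw [hN, h0, add_zero, form_self])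
      have hline : ∀ t, (∀ z, form z w = 0 → form z (N (N t)) = 0) → N (N t) = 0 := by
        intro t ht
        obtain ⟨c, hc⟩ := mem_span_singleton_of_form ht
        have := h3 t
        rw [hc, map_smul, smul_eq_zero] at this
        rw [hc, this.resolve_right hNw, zero_smul]
      have hperp : ∀ t, form t w = 0 → N (N t) = 0 := by
        intro t ht
        refine hline t fun z hz => ?_
        have e := h1 (z + t) (by rw [map_add, LinearMap.add_apply, hz, ht, add_zero])
        simp only [map_add, LinearMap.add_apply] at e
        rw [CharTwo.add_sq, ← h1 z hz, ← h1 t ht] at e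
        have e' : (form z (T t) + form t (T z)) * form w (T w) = 0 := by linear_combination e
        rw [form_apply_right hTT' hω t z, ← map_add, hT', hN t] at e'
        have e2 : t + N t + (t + N t + N (N t)) = N (N t) := by
          linear_combination (norm := module) vec_add_self t + vec_add_self (N t)
        rw [e2] at e'
        exact (mul_eq_zero.1 e').resolve_right hq
      obtain ⟨t, ht⟩ := hne
      refine absurd (hline t fun z hz => ?_) ht
      rw [← hself, hperp z hz, map_zero, LinearMap.zero_apply]
  obtain ⟨t, ht⟩ := hne
  exact ht (key (N t) (h3 t))

end CharTwo

end SympCharTwo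

namespace SympCharTwo

section Covariants

variable {k n}

lemma exists_orthogonal_notMem_span (hn : 2 ≤ n) (v : Fin n ⊕ Fin n → k) :
    ∃ w, form v w = 0 ∧ w ∉ Submodule.span k {v} := by
  by_contra! h
  have hle : LinearMap.ker (form v) ≤ Submodule.span k {v} := fun w hw => h w hw
  have h1 := Submodule.finrank_mono hle
  have h2 := LinearMap.finrank_range_add_finrank_ker (form v)
  have h3 := Submodule.finrank_le (LinearMap.range (form v))
  have h4 := finrank_span_le_card (R := k) ({v} : Set (Fin n ⊕ Fin n → k))
  simp at h2 h3 h4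
  omega

lemma linearIndependent_pair_of_notMem {v w : Fin n ⊕ Fin n → k} (hv : v ≠ 0)
    (hw : w ∉ Submodule.span k {v}) : LinearIndependent k ![v, w] :=
  (LinearIndependent.pair_iff' hv).2 fun a ha => hw (Submodule.mem_span_singleton.2 ⟨a, ha⟩)

/-- A covariant function of a group element and a flag, of weight `χ`. -/
def IsCov (χ : k → k → k)
    (Φ : SpGroup k n → (Fin n ⊕ Fin n → k) → (Fin n ⊕ Fin n → k) → k) : Prop :=
  (∀ v w, IsReg fun y => Φ y v w) ∧
  (∀ g y v w, Φ (g * y * g⁻¹) (mat g *ᵥ v) (mat g *ᵥ w) = Φ y v w) ∧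
  ∀ y v w (α β γ : k), Φ y (α • v) (β • w + γ • v) = χ α β * Φ y v w

lemma mat_mulVec_inv_mulVec (g : SpGroup k n) (v : Fin n ⊕ Fin n → k) :
    mat g *ᵥ (mat g⁻¹ *ᵥ v) = v := by
  rw [Matrix.mulVec_mulVec, mat_mul_inv, Matrix.one_mulVec]

lemma mat_inv_mulVec_mulVec (g : SpGroup k n) (v : Fin n ⊕ Fin n → k) :
    mat g⁻¹ *ᵥ (mat g *ᵥ v) = v := by
  rw [Matrix.mulVec_mulVec, mat_inv_mul, Matrix.one_mulVec]

/-- Covariants of equal weight are proportional on a class with a dense orbit of a connected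
solvable group. -/
lemma IsCov.eq_zero_or_exists_eq_mul [IsAlgClosed k] (hn : 2 ≤ n) {B : Subgroup (SpGroup k n)}
    (hB : IsPreconnected (B : Set (SpGroup k n))) (hs : Group.IsSolvable B) {u x : SpGroup k n}
    (hd : conjClass u ⊆ closure (conjOrbit B x)) {χ : k → k → k}
    {Φ Ψ : SpGroup k n → (Fin n ⊕ Fin n → k) → (Fin n ⊕ Fin n → k) → k}
    (hΦ : IsCov χ Φ) (hΨ : IsCov χ Ψ) :
    (∀ v w, LinearIndependent k ![v, w] → form v w = 0 → Φ u v w = 0) ∨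
      ∃ c, ∀ v w, LinearIndependent k ![v, w] → form v w = 0 → Ψ u v w = c * Φ u v w := by
  obtain ⟨v₁, -, hv₁, hBv₁⟩ := exists_relative_eigenvector hB hs (W := ⊥) (N := ⊤)
    (fun g _ v hv => by
      rw [Submodule.mem_bot] at hv
      simp [hv]) (fun _ _ _ _ => trivial) (by
      refine bot_lt_iff_ne_bot.2 fun h => ?_
      have h1 : Pi.single (Sum.inl ⟨0, by omega⟩) 1 ∈ (⊤ : Submodule k (Fin n ⊕ Fin n → k)) :=
        trivial
      rw [h, Submodule.mem_bot] at h1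
      simp at h1)
  simp only [Submodule.mem_bot, sub_eq_zero] at hv₁ hBv₁
  obtain ⟨v₂, hv₂, hv₂', hBv₂⟩ := exists_relative_eigenvector hB hs
    (W := Submodule.span k {v₁}) (N := LinearMap.ker (form v₁))
    (fun g hg v hv => by
      obtain ⟨a, rfl⟩ := Submodule.mem_span_singleton.1 hv
      obtain ⟨c, hc⟩ := hBv₁ g hg
      rw [Matrix.mulVec_smul, hc]
      exact Submodule.smul_mem _ _ (Submodule.smul_mem _ _ (Submodule.mem_span_singleton_self _)))
    (fun g hg v hv => by
      rw [LinearMap.mem_ker] at hv ⊢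
      obtain ⟨c, hc⟩ := hBv₁ g⁻¹ (inv_mem hg)
      rw [← form_mat g⁻¹, hc, mat_inv_mulVec_mulVec, map_smul, LinearMap.smul_apply, hv, smul_zero])
    (by
      obtain ⟨w, hw, hw'⟩ := exists_orthogonal_notMem_span hn v₁
      refine lt_of_le_of_ne ?_ fun h => hw' (h ▸ hw)
      rw [Submodule.span_singleton_le_iff_mem, LinearMap.mem_ker]
      exact form_self _)
  have hli := linearIndependent_pair_of_notMem hv₁ hv₂'
  have horbit : ∀ b ∈ B, ∃ a, ∀ Φ, IsCov χ Φ →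
      Φ (b * x * b⁻¹) v₁ v₂ = a * Φ x v₁ v₂ := by
    intro b hb
    obtain ⟨α, hα⟩ := hBv₁ b⁻¹ (inv_mem hb)
    obtain ⟨β, hβ⟩ := hBv₂ b⁻¹ (inv_mem hb)
    obtain ⟨γ, hγ⟩ := Submodule.mem_span_singleton.1 hβ
    refine ⟨χ α β, fun Φ hΦ => ?_⟩
    have h2 : mat b⁻¹ *ᵥ v₂ = β • v₂ + γ • v₁ := by
      rw [hγ]
      abel
    rw [← hΦ.2.2 x v₁ v₂ α β γ, ← h2, ← hα, ← hΦ.2.1 b x, mat_mulVec_inv_mulVec,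
      mat_mulVec_inv_mulVec]
  have htrans : ∀ v w, LinearIndependent k ![v, w] → form v w = 0 →
      ∃ g : SpGroup k n, ∀ Φ, IsCov χ Φ → Φ u v w = Φ (g * u * g⁻¹) v₁ v₂ := by
    intro v w hvw h0
    obtain ⟨g, -, hg⟩ := exists_isJoined_mulVec_eq 2 ![v, w] ![v₁, v₂] hvw hli
      (by
        intro i j
        fin_cases i <;> fin_cases j <;> simp [form_self, h0, form_neg_comm w v])
      (by
        rw [LinearMap.mem_ker] at hv₂
        intro i j
        fin_cases i <;> fin_cases j <;> simp [form_self, hv₂, form_neg_comm v₂ v₁])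
    refine ⟨g, fun Φ hΦ => ?_⟩
    have h1 := hg 0
    have h2 := hg 1
    simp only [Matrix.cons_val_zero, Matrix.cons_val_one] at h1 h2
    rw [← hΦ.2.1 g, h1, h2]
  have hconj : ∀ g, g * u * g⁻¹ ∈ closure (conjOrbit B x) := fun g =>
    hd (isConj_iff.2 ⟨g, rfl⟩)
  by_cases hc : Φ x v₁ v₂ = 0
  · left
    intro v w hvw h0
    obtain ⟨g, hg⟩ := htrans v w hvw h0
    rw [hg Φ hΦ]
    refine closure_minimal ?_ (isClosed_eq_zero (hΦ.1 v₁ v₂)) (hconj g)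
    rintro _ ⟨b, hb, rfl⟩
    obtain ⟨a, ha⟩ := horbit b hb
    rw [Set.mem_ofPred_eq, ha Φ hΦ, hc, mul_zero]
  · right
    refine ⟨Ψ x v₁ v₂ / Φ x v₁ v₂, fun v w hvw h0 => ?_⟩
    obtain ⟨g, hg⟩ := htrans v w hvw h0
    rw [hg Φ hΦ, hg Ψ hΨ, ← sub_eq_zero]
    refine closure_minimal ?_ (isClosed_eq_zero
      ((hΨ.1 v₁ v₂).sub ((IsReg.const _).mul (hΦ.1 v₁ v₂)))) (hconj g)
    rintro _ ⟨b, hb, rfl⟩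
    obtain ⟨a, ha⟩ := horbit b hb
    rw [Set.mem_ofPred_eq, ha Φ hΦ, ha Ψ hΨ]
    field_simp
    ring

/-- The pairing `⟨v, y ^ j w⟩`. -/
def pairing (j : ℕ) (y : SpGroup k n) (v w : Fin n ⊕ Fin n → k) : k :=
  form v (mat (y ^ j) *ᵥ w)

lemma isReg_pairing (j : ℕ) (v w : Fin n ⊕ Fin n → k) : IsReg fun y => pairing j y v w := by
  refine isReg_sympForm v w ?_
  induction j with
  | zero =>
    simp only [pow_zero]
    exact IsRegMap.const 1
  | succ j ih =>
    simp only [pow_succ]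
    exact ih.mul isRegMap_id

lemma pairing_conj (j : ℕ) (g y : SpGroup k n) (v w : Fin n ⊕ Fin n → k) :
    pairing j (g * y * g⁻¹) (mat g *ᵥ v) (mat g *ᵥ w) = pairing j y v w := by
  rw [pairing, conj_pow, mat_mul, mat_mul, ← Matrix.mulVec_mulVec, ← Matrix.mulVec_mulVec,
    mat_inv_mulVec_mulVec, form_mat, pairing]

lemma pairing_add_right (j : ℕ) (y : SpGroup k n) (v w w' : Fin n ⊕ Fin n → k) :
    pairing j y v (w + w') = pairing j y v w + pairing j y v w' := by
  simp [pairing, Matrix.mulVec_add]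

lemma pairing_add_left (j : ℕ) (y : SpGroup k n) (v v' w : Fin n ⊕ Fin n → k) :
    pairing j y (v + v') w = pairing j y v w + pairing j y v' w := by
  simp [pairing]

lemma pairing_smul_right (j : ℕ) (y : SpGroup k n) (c : k) (v w : Fin n ⊕ Fin n → k) :
    pairing j y v (c • w) = c * pairing j y v w := by
  simp [pairing, Matrix.mulVec_smul]

lemma pairing_smul_left (j : ℕ) (y : SpGroup k n) (c : k) (v w : Fin n ⊕ Fin n → k) :
    pairing j y (c • v) w = c * pairing j y v w := by
  simp [pairing]

lemma isCov_pairing_self (j : ℕ) :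
    IsCov (n := n) (fun α _ : k => α ^ 2) fun y v _ => pairing j y v v :=
  ⟨fun v _ => isReg_pairing j v v, fun g y v _ => pairing_conj j g y v v, fun y v _ α _ _ => by
    simp only [pairing_smul_left, pairing_smul_right]
    ring⟩

/-- The Gram determinant of the pairings `i` and `j`. -/
def gram (i j : ℕ) (y : SpGroup k n) (v w : Fin n ⊕ Fin n → k) : k :=
  pairing i y v v * pairing j y w w - pairing i y v w * pairing j y w v

lemma isReg_gram (i j : ℕ) (v w : Fin n ⊕ Fin n → k) : IsReg fun y => gram i j y v w :=
  ((isReg_pairing i v v).mul (isReg_pairing j w w)).sub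
    ((isReg_pairing i v w).mul (isReg_pairing j w v))

lemma isCov_gram_self (i : ℕ) : IsCov (n := n) (fun α β : k => (α * β) ^ 2) (gram i i) := by
  refine ⟨isReg_gram i i, fun g y v w => by simp only [gram, pairing_conj],
    fun y v w α β γ => ?_⟩
  simp only [gram, pairing_add_left, pairing_add_right, pairing_smul_left, pairing_smul_right]
  ring

lemma isCov_gram_add (i j : ℕ) :
    IsCov (n := n) (fun α β : k => (α * β) ^ 2) fun y v w => gram i j y v w + gram j i y v w := by
  refine ⟨fun v w => (isReg_gram i j v w).add (isReg_gram j i v w),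
    fun g y v w => by simp only [gram, pairing_conj], fun y v w α β γ => ?_⟩
  simp only [gram, pairing_add_left, pairing_add_right, pairing_smul_left, pairing_smul_right]
  ring

/-- Covariants of weight `(αβ)²` vanish on dependent pairs. -/
lemma IsCov.eq_zero_of_not_linearIndependent
    {Φ : SpGroup k n → (Fin n ⊕ Fin n → k) → (Fin n ⊕ Fin n → k) → k}
    (hΦ : IsCov (fun α β : k => (α * β) ^ 2) Φ) (y : SpGroup k n) {v w : Fin n ⊕ Fin n → k}
    (h : ¬ LinearIndependent k ![v, w]) : Φ y v w = 0 := by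
  by_cases hv : v = 0
  · have := hΦ.2.2 y v w 0 1 0
    simpa [hv] using this
  · rw [LinearIndependent.pair_iff' hv] at h
    push Not at h
    obtain ⟨a, rfl⟩ := h
    have := hΦ.2.2 y v 0 1 0 a
    simpa using this

/-- A unipotent class on which a connected solvable group has a dense orbit consists of
involutions. -/
theorem sq_eq_one_of_dense_orbit [IsAlgClosed k] [CharP k 2] (hn : 2 ≤ n)
    {B : Subgroup (SpGroup k n)} (hB : IsPreconnected (B : Set (SpGroup k n)))
    (hs : Group.IsSolvable B) {u x : SpGroup k n} (hunip : IsNilpotent (mat u - 1))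
    (hd : conjClass u ⊆ closure (conjOrbit B x)) : u ^ 2 = 1 := by
  set T := Matrix.toLinAlgEquiv' (mat u) with hT
  set T' := Matrix.toLinAlgEquiv' (mat u⁻¹)
  set N := Matrix.toLinAlgEquiv' (mat u - 1) with hNdef
  have hTm : ∀ v, T v = mat u *ᵥ v := fun v => rfl
  have hTT' : ∀ v, T (T' v) = v := mat_mulVec_inv_mulVec u
  have hT'T : ∀ v, T' (T v) = v := mat_inv_mulVec_mulVec u
  have hω : ∀ v w, form (T v) (T w) = form v w := form_mat u
  have hN : ∀ v, T v = v + N v := fun v => by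
    rw [hNdef, map_sub, ← hT, map_one, LinearMap.sub_apply, Module.End.one_apply]
    abel
  have hnil : IsNilpotent N := hunip.map Matrix.toLinAlgEquiv'
  have hp₁ : ∀ v w, pairing 1 u v w = form v (T w) := fun v w => by rw [pairing, pow_one, hTm]
  have hp₂ : ∀ v w, pairing 2 u v w = form v (T (T w)) := fun v w => by
    rw [pairing, pow_two, mat_mul, ← Matrix.mulVec_mulVec, hTm, hTm]
  suffices h : ∀ v, N (N v) = 0 by
    refine mat_injective (Matrix.toLinAlgEquiv'.injective (LinearMap.ext fun v => ?_))
    have h1 : T (T v) = v := by rw [apply_apply_eq hN, h, add_zero]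
    rw [pow_two, mat_mul, map_mul, mat_one, map_one]
    exact h1
  have hext : ∀ {P : (Fin n ⊕ Fin n → k) → Prop}, P 0 →
      (∀ v w, LinearIndependent k ![v, w] → form v w = 0 → P v) → ∀ v, P v := by
    intro P h0 h v
    by_cases hv : v = 0
    · rwa [hv]
    · obtain ⟨w, hw, hw'⟩ := exists_orthogonal_notMem_span hn v
      exact h v w (linearIndependent_pair_of_notMem hv hw') hw
  rcases IsCov.eq_zero_or_exists_eq_mul hn hB hs hd (isCov_pairing_self 1)
    (isCov_pairing_self 2) with h | ⟨c, h⟩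
  · refine sq_eq_zero_of_form_apply_self hTT' hω hN (hext (by simp) fun v w hvw h0 => ?_)
    rw [← hp₁]
    exact h v w hvw h0
  have h12 : ∀ v, form v (T (T v)) = c * form v (T v) := hext (by simp) fun v w hvw h0 => by
    rw [← hp₂, ← hp₁]
    exact h v w hvw h0
  rcases sq_eq_zero_or_of_form_sq hTT' hT'T hω hN hnil h12 with h | ⟨hq, -⟩
  · exact h
  have hsymm : ∀ v w, form v w = 0 → form w (T (T v)) = form v (N (N w)) ∧
      form v (T (T w)) = form v (N (N w)) := by
    intro v w h0
    have h1 := hq (v + w)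
    simp only [map_add, LinearMap.add_apply, hq, zero_add, add_zero] at h1
    have h2 : form v (T (T w)) = form v (N (N w)) := by
      rw [apply_apply_eq hN, map_add, h0, zero_add]
    exact ⟨by rw [← h2]; exact CharTwo.add_eq_zero.1 h1, h2⟩
  have hg₂ : ∀ v w, form v w = 0 → gram 2 2 u v w = form v (N (N w)) ^ 2 := by
    intro v w h0
    rw [gram, hp₂, hp₂, hp₂, hp₂, hq, (hsymm v w h0).1, (hsymm v w h0).2, CharTwo.sub_eq_add]
    ring
  have hprop : ∀ {Ψ : SpGroup k n → (Fin n ⊕ Fin n → k) → (Fin n ⊕ Fin n → k) → k},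
      IsCov (fun α β : k => (α * β) ^ 2) Ψ → (∀ v, N (N v) = 0) ∨
        ∃ c, ∀ v w, form v w = 0 → Ψ u v w = c * form v (N (N w)) ^ 2 := by
    intro Ψ hΨ
    rcases IsCov.eq_zero_or_exists_eq_mul hn hB hs hd (isCov_gram_self 2) hΨ with h | ⟨c, h⟩
    · refine Or.inl (sq_eq_zero_of_forall_orthogonal hnil fun v w h0 => ?_)
      have : gram 2 2 u v w = 0 := by
        by_cases hvw : LinearIndependent k ![v, w]
        · exact h v w hvw h0
        · exact (isCov_gram_self 2).eq_zero_of_not_linearIndependent u hvw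
      rw [hg₂ v w h0] at this
      exact pow_eq_zero_iff two_ne_zero |>.1 this
    · refine Or.inr ⟨c, fun v w h0 => ?_⟩
      rw [← hg₂ v w h0]
      by_cases hvw : LinearIndependent k ![v, w]
      · exact h v w hvw h0
      · rw [(isCov_gram_self 2).eq_zero_of_not_linearIndependent u hvw,
          hΨ.eq_zero_of_not_linearIndependent u hvw, mul_zero]
  rcases hprop (isCov_gram_add 1 2) with h | ⟨c, h⟩
  · exact h
  have h3 : ∀ v, N (N (N v)) = 0 := by
    refine cube_eq_zero_of_form hTT' hT'T hN hnil (c := c) fun v w h0 => ?_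
    rw [← h v w h0, gram, gram, hp₁, hp₁, hp₁, hp₁, hp₂, hp₂, hp₂, hp₂, hq, hq,
      (hsymm v w h0).1, (hsymm v w h0).2, form_apply_right hTT' hω w v, map_add]
    simp only [CharTwo.sub_eq_add]
    ring
  rcases hprop (isCov_gram_self 1) with h | ⟨a, h⟩
  · exact h
  refine sq_eq_zero_of_cube_eq_zero hTT' hT'T hω hN hnil h3 fun v w h0 h0' => ?_
  have := h v w h0
  rw [gram, hp₁, hp₁, hp₁, hp₁, h0'] at this
  linear_combination this

end Covariants

end SympCharTwo

namespace SympCharTwo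

section Blocks

variable {k n}

/-- The element of the symplectic group with prescribed blocks. -/
def mkBlocks (A B C D : Matrix (Fin n) (Fin n) k)
    (h : Aᵀ * C = Cᵀ * A ∧ Bᵀ * D = Dᵀ * B ∧ Aᵀ * D - Cᵀ * B = 1) : SpGroup k n :=
  mk (Matrix.fromBlocks A B C D)
    ((preserves_iff _).2 (SymplecticGroup.mem_iff'.1 (SymplecticGroup.fromBlocks_mem_iff.2 h)))

lemma toBlocks_relations (g : SpGroup k n) :
    (mat g).toBlocks₁₁ᵀ * (mat g).toBlocks₂₁ = (mat g).toBlocks₂₁ᵀ * (mat g).toBlocks₁₁ ∧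
    (mat g).toBlocks₁₂ᵀ * (mat g).toBlocks₂₂ = (mat g).toBlocks₂₂ᵀ * (mat g).toBlocks₁₂ ∧
    (mat g).toBlocks₁₁ᵀ * (mat g).toBlocks₂₂ - (mat g).toBlocks₂₁ᵀ * (mat g).toBlocks₁₂ = 1 := by
  have := mat_mem g
  rw [← (mat g).fromBlocks_toBlocks] at this
  exact SymplecticGroup.fromBlocks_mem_iff.1 this

/-- The Levi subgroup of the stabiliser of a Lagrangian. -/
def levi : GL (Fin n) k →* SpGroup k n where
  toFun P := mkBlocks P.1 0 0 (P⁻¹).1ᵀ (by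
    refine ⟨by simp, by simp, ?_⟩
    rw [← Matrix.transpose_mul, ← Units.val_mul, inv_mul_cancel]
    simp)
  map_one' := mat_injective (by simp [mkBlocks])
  map_mul' P Q := mat_injective (by
    rw [mat_mul]
    simp [mkBlocks, Matrix.fromBlocks_multiply])

lemma mat_levi (P : GL (Fin n) k) : mat (levi P) = Matrix.fromBlocks P.1 0 0 (P⁻¹).1ᵀ := rfl

/-- The unipotent element with an upper right symmetric block. -/
def upper (S : Matrix (Fin n) (Fin n) k) (hS : S.IsSymm) : SpGroup k n :=
  mkBlocks 1 S 0 1 (by simp [hS.eq])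

lemma mat_upper (S : Matrix (Fin n) (Fin n) k) (hS : S.IsSymm) :
    mat (upper S hS) = Matrix.fromBlocks 1 S 0 1 := rfl

/-- The unipotent element with a lower left symmetric block. -/
def lower (S : Matrix (Fin n) (Fin n) k) (hS : S.IsSymm) : SpGroup k n :=
  mkBlocks 1 0 S 1 (by simp [hS.eq])

lemma mat_lower (S : Matrix (Fin n) (Fin n) k) (hS : S.IsSymm) :
    mat (lower S hS) = Matrix.fromBlocks 1 0 S 1 := rfl

lemma levi_mul_lower (P : GL (Fin n) k) {S : Matrix (Fin n) (Fin n) k} (hS : S.IsSymm)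
    {T : Matrix (Fin n) (Fin n) k} (hT : T.IsSymm) (h : P.1ᵀ * T * P.1 = S) :
    levi P * lower S hS = lower T hT * levi P := by
  refine mat_injective ?_
  have : (P⁻¹).1ᵀ * P.1ᵀ = 1 := by
    rw [← Matrix.transpose_mul, ← Units.val_mul, mul_inv_cancel]
    simp
  rw [mat_mul, mat_mul, mat_levi, mat_lower, mat_lower, Matrix.fromBlocks_multiply,
    Matrix.fromBlocks_multiply, ← h, mul_assoc P.1ᵀ, ← mul_assoc (P⁻¹).1ᵀ P.1ᵀ, this]
  simp

lemma lower_mul_comm {S T : Matrix (Fin n) (Fin n) k} (hS : S.IsSymm) (hT : T.IsSymm) :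
    lower S hS * lower T hT = lower T hT * lower S hS := by
  refine mat_injective ?_
  rw [mat_mul, mat_mul, mat_lower, mat_lower, Matrix.fromBlocks_multiply,
    Matrix.fromBlocks_multiply]
  simp [add_comm]

/-- An element with trivial upper left block and zero lower left block. -/
lemma exists_eq_upper {g : SpGroup k n} (h₁ : (mat g).toBlocks₁₁ = 1)
    (h₂ : (mat g).toBlocks₂₁ = 0) : ∃ S hS, g = upper S hS := by
  obtain ⟨-, hB, hD⟩ := toBlocks_relations g
  rw [h₁, h₂] at hD
  simp only [Matrix.transpose_one, one_mul, Matrix.transpose_zero, zero_mul, sub_zero] at hD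
  rw [hD] at hB
  simp only [Matrix.transpose_one, one_mul, mul_one] at hB
  refine ⟨_, hB, mat_injective ?_⟩
  conv_lhs => rw [← (mat g).fromBlocks_toBlocks, h₁, h₂, hD]
  rfl

/-- An element with trivial lower right block and zero upper right block. -/
lemma exists_eq_lower {g : SpGroup k n} (h₁ : (mat g).toBlocks₂₂ = 1)
    (h₂ : (mat g).toBlocks₁₂ = 0) : ∃ S hS, g = lower S hS := by
  obtain ⟨hC, -, hA⟩ := toBlocks_relations g
  rw [h₁, h₂] at hA
  simp only [mul_one, mul_zero, sub_zero] at hA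
  rw [Matrix.transpose_eq_one] at hA
  rw [hA] at hC
  simp only [Matrix.transpose_one, one_mul, mul_one] at hC
  refine ⟨_, hC.symm, mat_injective ?_⟩
  conv_lhs => rw [← (mat g).fromBlocks_toBlocks, h₁, h₂, hA]
  rfl

/-- The parabolic subgroup stabilising the standard Lagrangian is the semidirect product of its
Levi subgroup and its unipotent radical. -/
lemma exists_eq_levi_mul_upper {g : SpGroup k n} (h : (mat g).toBlocks₂₁ = 0) :
    ∃ P S hS, P.1 = (mat g).toBlocks₁₁ ∧ g = levi P * upper S hS := by
  have hA := (toBlocks_relations g).2.2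
  rw [h] at hA
  simp only [Matrix.transpose_zero, zero_mul, sub_zero] at hA
  have hA' := congrArg Matrix.transpose hA
  rw [Matrix.transpose_mul, Matrix.transpose_transpose, Matrix.transpose_one] at hA'
  let P : GL (Fin n) k := ⟨(mat g).toBlocks₁₁, (mat g).toBlocks₂₂ᵀ,
    mul_eq_one_comm.1 hA', hA'⟩
  have hm : mat ((levi P)⁻¹ * g) = Matrix.fromBlocks 1 (P⁻¹.1 * (mat g).toBlocks₁₂) 0 1 := by
    rw [mat_mul, ← map_inv, mat_levi]
    conv_lhs => rw [← (mat g).fromBlocks_toBlocks, h]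
    rw [Matrix.fromBlocks_multiply, inv_inv]
    congr 1
    · rw [mul_zero, add_zero]
      exact hA'
    · simp
    · simp
    · rw [zero_mul, zero_add]
      exact hA
  obtain ⟨S, hS, hg⟩ := exists_eq_upper (g := (levi P)⁻¹ * g)
    (by rw [hm, Matrix.toBlocks_fromBlocks₁₁]) (by rw [hm, Matrix.toBlocks_fromBlocks₂₁])
  exact ⟨P, S, hS, rfl, by rw [← hg, mul_inv_cancel_left]⟩

/-- The decomposition of the open cell opposite to the stabiliser of the standard Lagrangian. -/
lemma exists_eq_upper_mul_levi_mul_lower {g : SpGroup k n}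
    (h : (mat g).toBlocks₂₂.det ≠ 0) :
    ∃ S hS P T hT, g = upper S hS * levi P * lower T hT := by
  set B := (mat g).toBlocks₁₂ with hB
  set D := (mat g).toBlocks₂₂ with hD
  have hu : IsUnit D.det := isUnit_iff_ne_zero.2 h
  have hu' : IsUnit Dᵀ.det := by rwa [Matrix.det_transpose]
  have hr : Bᵀ * D = Dᵀ * B := (toBlocks_relations g).2.1
  have hS : (B * D⁻¹).IsSymm := by
    rw [Matrix.IsSymm, Matrix.transpose_mul, Matrix.transpose_nonsing_inv]
    calc Dᵀ⁻¹ * Bᵀ = Dᵀ⁻¹ * (Bᵀ * D) * D⁻¹ := by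
          rw [mul_assoc, mul_assoc, Matrix.mul_nonsing_inv _ hu, mul_one]
      _ = B * D⁻¹ := by rw [hr, ← mul_assoc, Matrix.nonsing_inv_mul _ hu', one_mul]
  let Q : GL (Fin n) k := Matrix.GeneralLinearGroup.mk'' Dᵀ hu'
  have hQ : (Q⁻¹)⁻¹.1ᵀ = D := by
    rw [inv_inv]
    exact Matrix.transpose_transpose D
  have hm : mat ((upper (-(B * D⁻¹)) hS.neg) * g) =
      Matrix.fromBlocks ((mat g).toBlocks₁₁ + -(B * D⁻¹) * (mat g).toBlocks₂₁) 0
        (mat g).toBlocks₂₁ D := by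
    rw [mat_mul, mat_upper]
    conv_lhs => rw [← (mat g).fromBlocks_toBlocks, Matrix.fromBlocks_multiply]
    rw [← hB, ← hD]
    congr 1
    · simp
    · rw [neg_mul, mul_assoc, Matrix.nonsing_inv_mul _ hu]
      simp
    · simp
    · simp
  have hm' : mat (levi Q * (upper (-(B * D⁻¹)) hS.neg * g)) =
      Matrix.fromBlocks (Q.1 * ((mat g).toBlocks₁₁ + -(B * D⁻¹) * (mat g).toBlocks₂₁)) 0
        (Q⁻¹.1ᵀ * (mat g).toBlocks₂₁) 1 := by
    rw [mat_mul, hm, mat_levi, Matrix.fromBlocks_multiply]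
    congr 1
    · simp
    · simp
    · simp
    · rw [← hQ, ← Matrix.transpose_mul, ← Units.val_mul, inv_inv, mul_inv_cancel]
      simp
  obtain ⟨T, hT, hg⟩ := exists_eq_lower (g := levi Q * (upper (-(B * D⁻¹)) hS.neg * g))
    (by rw [hm', Matrix.toBlocks_fromBlocks₂₂]) (by rw [hm', Matrix.toBlocks_fromBlocks₁₂])
  refine ⟨B * D⁻¹, hS, Q⁻¹, T, hT, ?_⟩
  have hi : upper (B * D⁻¹) hS * upper (-(B * D⁻¹)) hS.neg = 1 := by
    refine mat_injective ?_
    rw [mat_mul, mat_upper, mat_upper, Matrix.fromBlocks_multiply]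
    simp
  rw [← hg, map_inv, mul_assoc, inv_mul_cancel_left, ← mul_assoc, hi, one_mul]

end Blocks

end SympCharTwo

namespace SympCharTwo

section StandardBorel

open Polynomial
open scoped commutatorElement

variable {k n}

/-- The position of a basis vector in the standard complete isotropic flag. -/
def ht : Fin n ⊕ Fin n → ℕ := Sum.elim (fun i => i) fun i => 2 * n - 1 - i

lemma ht_inl (i : Fin n) : ht (n := n) (Sum.inl i) = i := rfl

lemma ht_inr (i : Fin n) : ht (n := n) (Sum.inr i) = 2 * n - 1 - i := rfl

lemma ht_swap_add (a : Fin n ⊕ Fin n) : ht a.swap + ht a + 1 = 2 * n := by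
  rcases a with i | i <;> simp only [Sum.swap_inl, Sum.swap_inr, ht_inl, ht_inr] <;> omega

lemma ht_lt (a : Fin n ⊕ Fin n) : ht a < 2 * n := by
  have := ht_swap_add a
  omega

lemma ht_injective : Function.Injective (ht (n := n)) := by
  rintro (i | i) (j | j) h <;> simp only [ht_inl, ht_inr] at h
  · exact congrArg _ (Fin.ext h)
  · omega
  · omega
  · exact congrArg _ (Fin.ext (by omega))

lemma exists_ht_eq {i : ℕ} (h : i < 2 * n) : ∃ a : Fin n ⊕ Fin n, ht a = i := by
  by_cases hi : i < n
  · exact ⟨Sum.inl ⟨i, hi⟩, rfl⟩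
  · exact ⟨Sum.inr ⟨2 * n - 1 - i, by omega⟩, by simp only [ht_inr]; omega⟩

/-- The matrices which raise the standard flag by at least `m` steps. -/
def Raises (m : ℕ) (M : Matrix (Fin n ⊕ Fin n) (Fin n ⊕ Fin n) k) : Prop :=
  ∀ a b, M a b ≠ 0 → ht a + m ≤ ht b

lemma Raises.add {m : ℕ} {M N : Matrix (Fin n ⊕ Fin n) (Fin n ⊕ Fin n) k} (hM : Raises m M)
    (hN : Raises m N) : Raises m (M + N) := by
  intro a b h
  by_cases h' : M a b = 0
  · exact hN a b fun h'' => h (by simp [h', h''])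
  · exact hM a b h'

lemma Raises.neg {m : ℕ} {M : Matrix (Fin n ⊕ Fin n) (Fin n ⊕ Fin n) k} (hM : Raises m M) :
    Raises m (-M) := fun a b h => hM a b (by simpa using h)

lemma Raises.sub {m : ℕ} {M N : Matrix (Fin n ⊕ Fin n) (Fin n ⊕ Fin n) k} (hM : Raises m M)
    (hN : Raises m N) : Raises m (M - N) := sub_eq_add_neg M N ▸ hM.add hN.neg

lemma exists_of_mul_apply_ne_zero {M N : Matrix (Fin n ⊕ Fin n) (Fin n ⊕ Fin n) k}
    {a b : Fin n ⊕ Fin n} (h : (M * N) a b ≠ 0) : ∃ c, M a c ≠ 0 ∧ N c b ≠ 0 := by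
  rw [Matrix.mul_apply] at h
  obtain ⟨c, -, hc⟩ := Finset.exists_ne_zero_of_sum_ne_zero h
  exact ⟨c, left_ne_zero_of_mul hc, right_ne_zero_of_mul hc⟩

lemma Raises.mul {l m : ℕ} {M N : Matrix (Fin n ⊕ Fin n) (Fin n ⊕ Fin n) k} (hM : Raises l M)
    (hN : Raises m N) : Raises (l + m) (M * N) := by
  intro a b h
  obtain ⟨c, hc, hc'⟩ := exists_of_mul_apply_ne_zero h
  have h₁ := hM a c hc
  have h₂ := hN c b hc'
  omega

lemma Raises.mono {l m : ℕ} (h : l ≤ m) {M : Matrix (Fin n ⊕ Fin n) (Fin n ⊕ Fin n) k}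
    (hM : Raises m M) : Raises l M := fun a b hab => by
  have := hM a b hab
  omega

lemma raises_one : Raises 0 (1 : Matrix (Fin n ⊕ Fin n) (Fin n ⊕ Fin n) k) := by
  intro a b h
  by_cases hab : a = b
  · rw [hab, add_zero]
  · exact absurd (Matrix.one_apply_ne hab) h

/-- The subgroup of the elements preserving the standard flag which act trivially up to `m`
steps. -/
def flagSubgroup (m : ℕ) : Subgroup (SpGroup k n) where
  carrier := {g | Raises 0 (mat g) ∧ Raises m (mat g - 1)}
  mul_mem' := by
    rintro g h ⟨hg, hg'⟩ ⟨hh, hh'⟩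
    refine ⟨hg.mul hh, ?_⟩
    have : mat (g * h) - 1 = (mat g - 1) * mat h + (mat h - 1) := by
      rw [mat_mul]
      noncomm_ring
    rw [this]
    exact (hg'.mul hh).add hh'
  one_mem' := ⟨raises_one, fun a b h => by simp at h⟩
  inv_mem' := by
    rintro g ⟨hg, hg'⟩
    have h0 : Raises 0 (mat g⁻¹) := by
      have hJ : ∀ a b, Matrix.J (Fin n) k a b ≠ 0 → b = a.swap := by
        rintro (i | i) (j | j) h <;> simp [Matrix.J, Matrix.one_apply] at h ⊢
        · exact h.symm
        · exact h.symm
      rw [mat_inv]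
      refine Raises.neg ?_
      intro a b h
      obtain ⟨c, hc, h₃⟩ := exists_of_mul_apply_ne_zero h
      obtain ⟨d, h₁, h₂⟩ := exists_of_mul_apply_ne_zero hc
      replace h₁ := hJ _ _ h₁
      replace h₂ := hg _ _ h₂
      replace h₃ := hJ _ _ h₃
      have h₄ := ht_swap_add a
      have h₅ := ht_swap_add c
      subst h₁ h₃
      omega
    refine ⟨h0, ?_⟩
    have : mat g⁻¹ - 1 = -(mat g⁻¹ * (mat g - 1)) := by
      rw [mul_sub, mat_inv_mul, mul_one, neg_sub]
    rw [this]
    have := (h0.mul hg').neg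
    rwa [zero_add] at this

/-- The stabiliser of the standard flag. -/
def borel (k : Type*) [Field k] (n : ℕ) : Subgroup (SpGroup k n) := flagSubgroup 0

lemma mem_borel {g : SpGroup k n} : g ∈ borel k n ↔ Raises 0 (mat g) :=
  ⟨fun h => h.1, fun h => ⟨h, h.sub raises_one⟩⟩

lemma commutator_mem_flagSubgroup {m : ℕ} {g h : SpGroup k n} (hg : g ∈ flagSubgroup m)
    (hh : h ∈ flagSubgroup m) : ⁅g, h⁆ ∈ flagSubgroup (m + 1) := by
  have hB : ∀ {x : SpGroup k n}, x ∈ flagSubgroup m → x ∈ borel k n := fun hx =>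
    mem_borel.2 hx.1
  have hgi := mem_borel.1 (inv_mem (hB hg))
  have hhi := mem_borel.1 (inv_mem (hB hh))
  have key : Raises (m + 1) (mat g * mat h - mat h * mat g) := by
    have he : mat g * mat h - mat h * mat g =
        (mat g - 1) * (mat h - 1) - (mat h - 1) * (mat g - 1) := by noncomm_ring
    rcases Nat.eq_zero_or_pos m with rfl | hm
    · intro a b hab
      have h0 := ((hg.1.mul hh.1).sub (hh.1.mul hg.1)) a b hab
      have hne : ht a ≠ ht b := by
        intro hab'
        obtain rfl := ht_injective hab'
        have hd : ∀ {M N : Matrix (Fin n ⊕ Fin n) (Fin n ⊕ Fin n) k}, Raises 0 M → Raises 0 N →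
            (M * N) a a = M a a * N a a := by
          intro M N hM hN
          rw [Matrix.mul_apply]
          refine Finset.sum_eq_single a (fun c _ hc => ?_) (by simp)
          by_contra h0
          have h₁ := hM a c (left_ne_zero_of_mul h0)
          have h₂ := hN c a (right_ne_zero_of_mul h0)
          exact hc (ht_injective (by omega))
        rw [Matrix.sub_apply, hd hg.1 hh.1, hd hh.1 hg.1] at hab
        exact hab (by ring)
      omega
    · rw [he]
      exact ((hg.2.mul hh.2).sub (hh.2.mul hg.2)).mono (by omega)
  refine ⟨((hg.1.mul hh.1).mul hgi).mul hhi, ?_⟩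
  have : mat ⁅g, h⁆ - 1 = (mat g * mat h - mat h * mat g) * mat g⁻¹ * mat h⁻¹ := by
    rw [commutatorElement_def, mat_mul, mat_mul, mat_mul, sub_mul, sub_mul, mul_assoc (mat h),
      mat_mul_inv, mul_one, mat_mul_inv]
  rw [this]
  exact (key.mul hgi).mul hhi

lemma isSolvable_borel : Group.IsSolvable (borel k n) := by
  have h : ∀ m, derivedSeries (borel k n) m ≤ (flagSubgroup m).subgroupOf (borel k n) := by
    intro m
    induction m with
    | zero => exact fun g _ => g.2
    | succ m ih =>
      rw [derivedSeries_succ, Subgroup.commutator_le]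
      exact fun g hg h hh => commutator_mem_flagSubgroup (ih hg) (ih hh)
  refine ⟨2 * n, (Subgroup.eq_bot_iff_forall _).2 fun g hg => ?_⟩
  refine Subtype.ext (mat_injective (sub_eq_zero.1 ?_))
  ext a b
  by_contra hab
  have := (h _ hg).2 a b hab
  have := ht_lt b
  omega

lemma isClosed_borel : IsClosed (borel k n : Set (SpGroup k n)) := by
  have : (borel k n : Set (SpGroup k n)) =
      ⋂ a, ⋂ b, ⋂ (_ : ¬ ht a ≤ ht b), {g | mat g a b = 0} := by
    ext g
    simp only [SetLike.mem_coe, mem_borel, Raises, Set.mem_iInter, Set.mem_ofPred_eq, add_zero]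
    exact forall₂_congr fun a b => not_imp_comm.trans (by rfl)
  rw [this]
  exact isClosed_iInter fun a => isClosed_iInter fun b => isClosed_iInter fun _ =>
    isClosed_eq_zero (isReg_entry a b)

lemma levi_mem_borel {P : GL (Fin n) k} (hP : P.1.BlockTriangular id) : levi P ∈ borel k n := by
  have hP' : (P⁻¹).1.BlockTriangular id := by
    rw [Matrix.coe_units_inv]
    have := P.invertible
    exact Matrix.blockTriangular_inv_of_blockTriangular hP
  rw [mem_borel, mat_levi]
  rintro (i | i) (j | j) h
  · rw [ht_inl, ht_inl]
    exact not_lt.1 fun hij => h (hP hij)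
  · exact absurd rfl h
  · exact absurd rfl h
  · have : j ≤ i := not_lt.1 fun hij => h (hP' hij)
    rw [ht_inr, ht_inr]
    have := Fin.le_def.1 this
    omega

lemma upper_mem_borel {S : Matrix (Fin n) (Fin n) k} (hS : S.IsSymm) :
    upper S hS ∈ borel k n := by
  rw [mem_borel, mat_upper]
  rintro (i | i) (j | j) h
  · obtain rfl : i = j := by_contra fun hij => h (Matrix.one_apply_ne hij)
    rfl
  · rw [ht_inl, ht_inr]
    omega
  · exact absurd rfl h
  · obtain rfl : i = j := by_contra fun hij => h (Matrix.one_apply_ne hij)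
    rfl

lemma exists_eq_of_mem_borel {g : SpGroup k n} (hg : g ∈ borel k n) :
    ∃ P S hS, P.1.BlockTriangular id ∧ g = levi P * upper S hS := by
  have h := mem_borel.1 hg
  obtain ⟨P, S, hS, hP, hg⟩ := exists_eq_levi_mul_upper (g := g) (by
    ext i j
    by_contra hij
    have := h (Sum.inr i) (Sum.inl j) hij
    rw [ht_inl, ht_inr] at this
    omega)
  refine ⟨P, S, hS, fun i j hij => ?_, hg⟩
  rw [hP]
  by_contra h0
  exact absurd (h (Sum.inl i) (Sum.inl j) h0) (not_le.2 hij)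

lemma isRat_eval_inv (d : k[X]) : IsRat d fun s => (d.eval s)⁻¹ :=
  ⟨1, 1, fun s hs => by simp [hs]⟩

/-- The curve in the Levi subgroup interpolating linearly between `1` and `P`. -/
lemma exists_curve_levi (P : GL (Fin n) k) :
    ∃ (d : k[X]) (γ : k → GL (Fin n) k), IsCurve d (fun s => levi (γ s)) ∧ d.eval 0 ≠ 0 ∧
      d.eval 1 ≠ 0 ∧ ∀ s, d.eval s ≠ 0 → (γ s).1 = 1 + s • (P.1 - 1) := by
  have hr : ∀ i j, IsRat 1 fun s : k => (1 + s • (P.1 - 1)) i j := fun i j =>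
    (IsRat.const _ _).add ((IsRat.id _).mul (IsRat.const _ _))
  obtain ⟨d, hd⟩ := (IsRat.det hr).exists_eval
  have hr' : ∀ i j, IsRat d fun s : k => (1 + s • (P.1 - 1)) i j := fun i j =>
    (IsRat.const _ _).add ((IsRat.id _).mul (IsRat.const _ _))
  classical
  let γ : k → GL (Fin n) k := fun s => if h : IsUnit (1 + s • (P.1 - 1)).det then
    Matrix.GeneralLinearGroup.mk'' _ h else 1
  have hγ : ∀ s, d.eval s ≠ 0 → (γ s).1 = 1 + s • (P.1 - 1) := by
    intro s hs
    rw [← hd] at hs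
    have : IsUnit (1 + s • (P.1 - 1)).det := isUnit_iff_ne_zero.2 hs
    simp only [γ, dif_pos this]
    rfl
  have hγ' : ∀ s, d.eval s ≠ 0 → (γ s)⁻¹.1 = (d.eval s)⁻¹ • (1 + s • (P.1 - 1)).adjugate := by
    intro s hs
    rw [Matrix.coe_units_inv, hγ s hs, Matrix.inv_def, hd, Ring.inverse_eq_inv']
  refine ⟨d, γ, ?_, ?_, ?_, hγ⟩
  · have hcongr : ∀ {f f' : k → k}, IsRat d f' → (∀ s, d.eval s ≠ 0 → f s = f' s) →
        IsRat d f := by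
      rintro f f' ⟨m, Q, hQ⟩ h
      exact ⟨m, Q, fun s hs => by rw [h s hs, hQ s hs]⟩
    rintro (i | i) (j | j)
    · exact hcongr (hr' i j) fun s hs => congrFun (congrFun (hγ s hs) i) j
    · exact IsRat.const d 0
    · exact IsRat.const d 0
    · refine hcongr (f' := fun s => (d.eval s)⁻¹ * (1 + s • (P.1 - 1)).adjugate j i)
        ((isRat_eval_inv d).mul ?_) fun s hs => congrFun (congrFun (hγ' s hs) j) i
      simp only [Matrix.adjugate_apply]
      refine IsRat.det fun a b => ?_
      by_cases ha : a = i
      · subst ha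
        simp only [Matrix.updateRow_self]
        exact IsRat.const _ _
      · simp only [Matrix.updateRow_ne ha]
        exact hr' a b
  · rw [← hd]
    simp
  · rw [← hd, one_smul, add_sub_cancel]
    exact (Matrix.isUnit_iff_isUnit_det _).1 P.isUnit |>.ne_zero

lemma isCurve_upper {S : Matrix (Fin n) (Fin n) k} (hS : S.IsSymm) (d : k[X]) :
    IsCurve d fun s => upper (s • S) (hS.smul s) := by
  rintro (i | i) (j | j)
  · exact IsRat.const _ _
  · exact (IsRat.id _).mul (IsRat.const _ _)
  · exact IsRat.const _ _
  · exact IsRat.const _ _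

lemma isPreconnected_borel [Infinite k] : IsPreconnected (borel k n : Set (SpGroup k n)) := by
  refine isPreconnected_of_forall 1 fun g hg => ?_
  obtain ⟨P, S, hS, hP, rfl⟩ := exists_eq_of_mem_borel hg
  obtain ⟨d, γ, hγ, h0, h1, hγd⟩ := exists_curve_levi P
  refine ⟨(fun s => levi (γ s) * upper (s • S) (hS.smul s)) '' {s | d.eval s ≠ 0}, ?_,
    ⟨0, h0, ?_⟩, ⟨1, h1, ?_⟩, (hγ.mul (isCurve_upper hS d)).isPreconnected_image⟩
  · rintro _ ⟨s, hs, rfl⟩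
    refine mul_mem (levi_mem_borel ?_) (upper_mem_borel _)
    rw [hγd s hs]
    intro i j hij
    have h₁ := (hP.sub Matrix.blockTriangular_one) hij
    have h₂ := Matrix.blockTriangular_one (R := k) (b := (id : Fin n → Fin n)) hij
    rw [Matrix.add_apply, Matrix.smul_apply, h₁, h₂, smul_zero, add_zero]
  · have hγ0 : γ 0 = 1 := Units.ext (by rw [hγd 0 h0]; simp)
    refine mat_injective ?_
    change mat (levi (γ 0) * upper _ _) = _
    rw [hγ0, map_one, one_mul, mat_upper]
    simp
  · have hγ1 : γ 1 = P := Units.ext (by rw [hγd 1 h1]; simp)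
    refine mat_injective ?_
    simp only [hγ1, mat_mul, mat_upper, one_smul]

lemma form_single (v : Fin n ⊕ Fin n → k) (a : Fin n ⊕ Fin n) :
    form v (Pi.single a 1) = Sum.elim (fun _ => -1) (fun _ => 1) a * v a.swap := by
  rcases a with i | i <;> simp [form_apply, sympForm, Pi.single_apply]

lemma form_single_ne_zero {v : Fin n ⊕ Fin n → k} {a : Fin n ⊕ Fin n}
    (h : form v (Pi.single a 1) ≠ 0) : v a.swap ≠ 0 := by
  rw [form_single] at h
  exact right_ne_zero_of_mul h

lemma mem_borel_of_mulVec {g : SpGroup k n}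
    (h : ∀ c d, (mat g *ᵥ Pi.single d 1) c ≠ 0 → ht c ≤ ht d) : g ∈ borel k n :=
  mem_borel.2 fun c d hcd => h c d (by rwa [Matrix.mulVec_single_one, Matrix.col_apply])

/-- The element `v ↦ v + ⟨v, x⟩ y + ⟨v, y⟩ x` for orthogonal vectors `x` and `y`. -/
def eichler (x y : Fin n ⊕ Fin n → k) (h : form x y = 0) : SpGroup k n :=
  ofLin (LinearMap.id + (form.flip x).smulRight y + (form.flip y).smulRight x) fun v w => by
    have h' : form y x = 0 := by rw [form_neg_comm, h, neg_zero]
    simp only [LinearMap.add_apply, LinearMap.id_apply, LinearMap.smulRight_apply,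
      LinearMap.flip_apply, map_add, map_smul, LinearMap.smul_apply, smul_eq_mul, form_self,
      form_neg_comm x w, form_neg_comm y w, h, h']
    ring

lemma eichler_mulVec (x y : Fin n ⊕ Fin n → k) (h : form x y = 0) (v : Fin n ⊕ Fin n → k) :
    mat (eichler x y h) *ᵥ v = v + form v x • y + form v y • x := by
  rw [eichler, mat_ofLin_mulVec]
  simp

/-- A root element of the standard Borel subgroup moving one basis vector to another one. -/
lemma exists_root_element {a b : Fin n ⊕ Fin n} (hab : ht a < ht b) :
    ∃ g ∈ borel k n, ∃ ε : k, ε ≠ 0 ∧ ∀ v, (mat g *ᵥ v) b = v b ∧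
      (mat g *ᵥ v) a = v a + ε * v b := by
  have hne : a ≠ b := fun h => hab.ne (by rw [h])
  have hε : ∀ c : Fin n ⊕ Fin n, (Sum.elim (fun _ => -1) (fun _ => 1) c : k) ≠ 0 := by
    rintro (i | i) <;> simp
  have hsingle : ∀ {c d : Fin n ⊕ Fin n}, (Pi.single d 1 : Fin n ⊕ Fin n → k) c ≠ 0 → c = d :=
    fun h => by_contra fun h' => h (Pi.single_eq_of_ne h' 1)
  by_cases hba : b = a.swap
  · refine ⟨transv (Pi.single a 1) 1, mem_borel_of_mulVec fun c d h => ?_, _, hε a, fun v => ?_⟩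
    · rw [transv_mulVec] at h
      by_cases hc : (Pi.single d 1 : Fin n ⊕ Fin n → k) c = 0
      · simp only [Pi.add_apply, hc, zero_add, Pi.smul_apply, smul_eq_mul, one_mul] at h
        rw [hsingle (right_ne_zero_of_mul h),
          ← hsingle (form_single_ne_zero (left_ne_zero_of_mul h)), ← hba]
        exact hab.le
      · rw [hsingle hc]
    · rw [transv_mulVec, form_single, ← hba]
      simp [hne.symm]
  · have hba' : a ≠ b.swap := fun h => hba (by rw [h, Sum.swap_swap])
    have h0 : form (Pi.single b.swap 1 : Fin n ⊕ Fin n → k) (Pi.single a 1) = 0 := by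
      by_contra h
      exact hne (Sum.swap_leftInverse.injective (hsingle (form_single_ne_zero h)))
    have hbb : b ≠ b.swap := by rcases b with i | i <;> simp
    refine ⟨eichler _ _ h0, mem_borel_of_mulVec fun c d h => ?_, _, hε b.swap, fun v => ?_⟩
    · rw [eichler_mulVec] at h
      by_cases hc : (Pi.single d 1 : Fin n ⊕ Fin n → k) c = 0
      · simp only [Pi.add_apply, hc, zero_add, Pi.smul_apply, smul_eq_mul] at h
        by_cases h' : form (Pi.single d 1) (Pi.single b.swap 1) *
            (Pi.single a 1 : Fin n ⊕ Fin n → k) c = 0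
        · rw [h', zero_add] at h
          have h₁ := hsingle (right_ne_zero_of_mul h)
          have h₂ := hsingle (form_single_ne_zero (left_ne_zero_of_mul h))
          have h₃ := ht_swap_add a
          have h₄ := ht_swap_add b
          rw [h₁, ← h₂]
          omega
        · have h₁ := hsingle (right_ne_zero_of_mul h')
          have h₂ := hsingle (form_single_ne_zero (left_ne_zero_of_mul h'))
          rw [Sum.swap_swap] at h₂
          rw [h₁, ← h₂]
          exact hab.le
      · rw [hsingle hc]
    · rw [eichler_mulVec, form_single, form_single, Sum.swap_swap]
      simp [hne.symm, hba', hbb]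

/-- An eigenvector of the standard Borel subgroup modulo a step of the standard flag lies in the
next step. -/
lemma eq_zero_of_borel_eigenvector {v : Fin n ⊕ Fin n → k} {a b : Fin n ⊕ Fin n}
    (hab : ht a < ht b)
    (h : ∀ g ∈ borel k n, ∃ t : k, ∀ c, ht a ≤ ht c → (mat g *ᵥ v - t • v) c = 0) : v b = 0 := by
  obtain ⟨g, hg, ε, hε, hv⟩ := exists_root_element (k := k) hab
  obtain ⟨t, ht⟩ := h g hg
  have h₁ := ht a le_rfl
  have h₂ := ht b hab.le
  simp only [Pi.sub_apply, Pi.smul_apply, smul_eq_mul, (hv v).1, (hv v).2] at h₁ h₂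
  have h₃ : (1 - t) * v b = 0 := by linear_combination h₂
  rcases mul_eq_zero.1 h₃ with h₄ | h₄
  · exact (mul_eq_zero.1 (by linear_combination h₁ - v a * h₄ : ε * v b = 0)).resolve_left hε
  · exact h₄

/-- The steps of the standard flag. -/
def flag (k : Type*) [Field k] (n i : ℕ) : Submodule k (Fin n ⊕ Fin n → k) where
  carrier := {v | ∀ c, i ≤ ht c → v c = 0}
  add_mem' hv hw c hc := by simp [hv c hc, hw c hc]
  zero_mem' _ _ := rfl
  smul_mem' t v hv c hc := by simp [hv c hc]

/-- The standard Borel subgroup is a Borel subgroup. -/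
lemma isBorel_borel [IsAlgClosed k] : IsBorel (SpGroup k n) (borel k n) := by
  have : Infinite k := IsAlgClosed.instInfinite
  refine ⟨isClosed_borel, ⟨⟨1, one_mem _⟩, isPreconnected_borel⟩, isSolvable_borel,
    fun B' _ hB' hs hle => le_antisymm (fun g hg => ?_) hle⟩
  have key : ∀ i ≤ 2 * n, ∀ g ∈ B', ∀ v ∈ flag k n i, mat g *ᵥ v ∈ flag k n i := by
    intro i
    induction i with
    | zero =>
      intro _ g _ v hv
      rw [show v = 0 from funext fun c => hv c (Nat.zero_le _), Matrix.mulVec_zero]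
      exact zero_mem _
    | succ i ih =>
      intro hi
      obtain ⟨a, ha⟩ := exists_ht_eq (n := n) (i := i) (by omega)
      obtain ⟨v, -, hv, h⟩ := exists_relative_eigenvector (N := ⊤) hB'.isPreconnected hs
        (ih (by omega)) (fun _ _ _ _ => Submodule.mem_top) (lt_top_iff_ne_top.2 fun h => by
          have : (Pi.single a 1 : Fin n ⊕ Fin n → k) ∈ flag k n i := h ▸ Submodule.mem_top
          simpa using this a ha.ge)
      have hv0 : ∀ c, i + 1 ≤ ht c → v c = 0 := fun c hc =>
        eq_zero_of_borel_eigenvector (a := a) (by omega) fun g hg => by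
          obtain ⟨t, ht⟩ := h g (hle hg)
          exact ⟨t, fun c hc => ht c (ha ▸ hc)⟩
      have hva : v a ≠ 0 := fun h0 => hv fun c hc => by
        rcases hc.eq_or_lt with hc | hc
        · rwa [← ht_injective (ha.trans hc)]
        · exact hv0 c hc
      intro g hg w hw
      have hdec : w - (w a / v a) • v ∈ flag k n i := fun c hc => by
        rcases hc.eq_or_lt with hc | hc
        · rw [← ht_injective (ha.trans hc)]
          simp [hva]
        · simp [hw c hc, hv0 c hc]
      have hmono : flag k n i ≤ flag k n (i + 1) := fun x hx c hc => hx c (by omega)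
      obtain ⟨t, ht⟩ := h g hg
      have hgw : mat g *ᵥ w = mat g *ᵥ (w - (w a / v a) • v) +
          (w a / v a) • ((mat g *ᵥ v - t • v) + t • v) := by
        rw [Matrix.mulVec_sub, Matrix.mulVec_smul]
        module
      rw [hgw]
      exact add_mem (hmono (ih (by omega) g hg _ hdec)) (Submodule.smul_mem _ _
        (add_mem (hmono ht) (Submodule.smul_mem _ _ hv0)))
  refine mem_borel.2 fun a b hab => ?_
  by_contra hlt
  have := key (ht b + 1) (ht_lt b) g hg (Pi.single b 1)
    (fun c hc => Pi.single_eq_of_ne (fun h => by rw [h] at hc; omega) 1) a (by omega)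
  rw [Matrix.mulVec_single_one] at this
  exact hab this

end StandardBorel

end SympCharTwo

namespace SympCharTwo

section Involutions

variable {k n}

/-- Splitting off a vector of nonzero square. -/
def splitOne (N : Module.End k (Fin n ⊕ Fin n → k)) (w : Fin n ⊕ Fin n → k) :
    Module.End k (Fin n ⊕ Fin n → k) :=
  N - (form.flip w).smulRight w

lemma splitOne_apply (N : Module.End k (Fin n ⊕ Fin n → k)) (w t : Fin n ⊕ Fin n → k) :
    splitOne N w t = N t - form t w • w := by
  simp [splitOne]

/-- Splitting off a hyperbolic plane. -/
def splitTwo (N : Module.End k (Fin n ⊕ Fin n → k)) (p q : Fin n ⊕ Fin n → k) :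
    Module.End k (Fin n ⊕ Fin n → k) :=
  N - (form.flip q).smulRight p - (form.flip p).smulRight q

lemma splitTwo_apply (N : Module.End k (Fin n ⊕ Fin n → k)) (p q t : Fin n ⊕ Fin n → k) :
    splitTwo N p q t = N t - form t q • p - form t p • q := by
  simp [splitTwo]

variable {N : Module.End k (Fin n ⊕ Fin n → k)}

lemma splitOne_symm (hsym : ∀ v w, form v (N w) = form w (N v)) (x : Fin n ⊕ Fin n → k) :
    ∀ v w, form v (splitOne N x w) = form w (splitOne N x v) := by
  intro v w
  simp only [splitOne_apply, map_sub, map_smul, smul_eq_mul, hsym v w]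
  ring

lemma range_splitOne_lt (hsym : ∀ v w, form v (N w) = form w (N v)) {v : Fin n ⊕ Fin n → k}
    (hv : form v (N v) = 1) :
    LinearMap.range (splitOne N (N v)) < LinearMap.range N ∧
      N v ∉ LinearMap.range (splitOne N (N v)) := by
  have hle : LinearMap.range (splitOne N (N v)) ≤ LinearMap.range N := by
    rintro _ ⟨t, rfl⟩
    rw [splitOne_apply, ← map_smul, ← map_sub]
    exact ⟨_, rfl⟩
  have hnot : N v ∉ LinearMap.range (splitOne N (N v)) := by
    rintro ⟨t, ht⟩
    have := congrArg (form v) ht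
    rw [splitOne_apply, map_sub, map_smul, hv, hsym v t] at this
    simp at this
  exact ⟨lt_of_le_of_ne hle fun h => hnot (h ▸ ⟨v, rfl⟩), hnot⟩

lemma sum_ite_lt {r : ℕ} (hr : r ≤ n) (f : Fin n → k) :
    ∑ i : Fin n, (if (i : ℕ) < r then f i else 0) = ∑ i : Fin r, f (Fin.castLE hr i) := by
  obtain ⟨d, rfl⟩ := Nat.exists_eq_add_of_le hr
  rw [Fin.sum_univ_add]
  simp [Fin.castLE, Fin.castAdd]

/-- Writing an involution in a basis adapted to its image. -/
lemma exists_conj_eq_lower_of_sum {u : SpGroup k n} {r : ℕ} (hr : r ≤ n)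
    {w : Fin r → Fin n ⊕ Fin n → k} (hw : LinearIndependent k w)
    (hi : ∀ i j, form (w i) (w j) = 0) {c : ℕ → ℕ → k} (hc : ∀ i j, c i j = c j i)
    (hu : ∀ t, mat u *ᵥ t =
      t + ∑ i : Fin r, ∑ j : Fin r, (c i j * form t (w i)) • w j) :
    ∃ (g : SpGroup k n) (S : Matrix (Fin n) (Fin n) k) (hS : S.IsSymm),
      g * u * g⁻¹ = lower S hS ∧
      ∀ i j, S i j = if (i : ℕ) < r ∧ (j : ℕ) < r then c i j else 0 := by
  obtain ⟨g, -, hg⟩ := exists_isJoined_mulVec_eq r w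
    (fun i => Pi.single (Sum.inr (Fin.castLE hr i)) 1) hw
    (by simpa [Function.comp_def, Pi.basisFun_apply] using
        (Pi.basisFun k (Fin n ⊕ Fin n)).linearIndependent.comp
          (fun i : Fin r => Sum.inr (Fin.castLE hr i))
          (Sum.inr_injective.comp (Fin.castLE_injective hr)))
    hi (fun i j => by simp [form_single])
  set S : Matrix (Fin n) (Fin n) k :=
    Matrix.of fun i j => if (i : ℕ) < r ∧ (j : ℕ) < r then c i j else 0 with hSdef
  have hS : S.IsSymm := by
    ext i j
    simp only [hSdef, Matrix.transpose_apply, Matrix.of_apply, and_comm, hc]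
  refine ⟨g, S, hS, mat_injective ?_, fun i j => rfl⟩
  refine Matrix.ext_of_mulVec_single fun a => ?_
  generalize (Pi.single a 1 : Fin n ⊕ Fin n → k) = t
  have hform : ∀ i, form (mat g⁻¹ *ᵥ t) (w i) = t (Sum.inl (Fin.castLE hr i)) := fun i => by
    rw [← form_mat g, hg, mat_mulVec_inv_mulVec, form_single]
    simp
  rw [mat_mul, mat_mul, ← Matrix.mulVec_mulVec, ← Matrix.mulVec_mulVec, hu, Matrix.mulVec_add,
    mat_mulVec_inv_mulVec, Matrix.mulVec_sum]
  simp only [Matrix.mulVec_sum, Matrix.mulVec_smul, hg, hform, mat_lower]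
  funext b
  rcases b with b | b
  · simp [Matrix.fromBlocks_mulVec, Finset.sum_apply]
  · have hb : ∀ j : Fin r, (b = Fin.castLE hr j ↔ (j : ℕ) = b) := fun j => by
      rw [Fin.ext_iff, Fin.val_castLE, eq_comm]
    simp only [Pi.add_apply, Finset.sum_apply, Pi.smul_apply, Pi.single_apply, smul_eq_mul,
      Sum.inr.injEq, Matrix.fromBlocks_mulVec, Sum.elim_inr, Matrix.one_mulVec,
      Function.comp_apply]
    rw [add_comm]
    congr 1
    have key := sum_ite_lt hr fun i : Fin n =>
      (if (b : ℕ) < r then c i b else 0) * t (Sum.inl i)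
    trans ∑ i : Fin n, (if (i : ℕ) < r then (if (b : ℕ) < r then c i b else 0) * t (Sum.inl i)
      else 0)
    · rw [key]
      refine Finset.sum_congr rfl fun i _ => ?_
      by_cases hbr : (b : ℕ) < r
      · rw [Finset.sum_eq_single ⟨b, hbr⟩]
        · simp [hbr]
        · intro j _ hj
          rw [if_neg, mul_zero]
          rw [hb]
          exact fun h => hj (Fin.ext h)
        · simp
      · rw [if_neg hbr, zero_mul]
        refine Finset.sum_eq_zero fun j _ => ?_
        rw [if_neg, mul_zero]
        rw [hb]
        exact fun h => hbr (h ▸ j.2)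
    · rw [Matrix.mulVec, dotProduct]
      refine Finset.sum_congr rfl fun i _ => ?_
      simp only [hSdef, Matrix.of_apply, Function.comp_apply, hc b]
      by_cases h₁ : (i : ℕ) < r <;> by_cases h₂ : (b : ℕ) < r <;> simp [h₁, h₂]

variable [CharP k 2]

/-- A nonalternating form contains a vector of square one with alternating complement only if
that complement is zero. -/
lemma exists_splitOne [IsAlgClosed k] (hsym : ∀ v w, form v (N w) = form w (N v))
    (hna : ∃ v, form v (N v) ≠ 0) :
    ∃ v, form v (N v) = 1 ∧ (splitOne N (N v) = 0 ∨
      ∃ t, form t (splitOne N (N v) t) ≠ 0) := by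
  have h2 : (2 : k) = 0 := CharTwo.two_eq_zero
  have hex : ∃ v, form v (N v) = 1 := by
    obtain ⟨v, hv⟩ := hna
    obtain ⟨c, hc⟩ := IsAlgClosed.exists_pow_nat_eq (form v (N v))⁻¹ (n := 2) (by norm_num)
    refine ⟨c • v, ?_⟩
    simp only [map_smul, LinearMap.smul_apply, smul_eq_mul]
    rw [← mul_assoc, ← pow_two, hc, inv_mul_cancel₀ hv]
  obtain ⟨v, hv⟩ := hex
  by_cases halt : ∃ t, form t (splitOne N (N v) t) ≠ 0
  · exact ⟨v, hv, Or.inr halt⟩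
  push Not at halt
  by_cases h0 : splitOne N (N v) = 0
  · exact ⟨v, hv, Or.inl h0⟩
  have hab : ∃ a b, form a (splitOne N (N v) b) = 1 := by
    by_contra! h
    refine h0 (LinearMap.ext fun b => eq_zero_of_form fun a => ?_)
    by_contra hab
    refine h ((form a (splitOne N (N v) b))⁻¹ • a) b ?_
    rw [map_smul, LinearMap.smul_apply, smul_eq_mul, inv_mul_cancel₀ hab]
  obtain ⟨a, b, hab⟩ := hab
  have ha := halt a
  have hb := halt b
  simp only [splitOne_apply, map_sub, map_smul, smul_eq_mul] at ha hb hab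
  have hva : form v (N a) = form a (N v) := hsym v a
  have hvb : form v (N b) = form b (N v) := hsym v b
  have hba : form b (N a) = form a (N b) := hsym b a
  refine ⟨v + (a - form a (N v) • v), ?_, Or.inr ⟨b - form b (N v) • v, ?_⟩⟩
  · simp only [map_add, map_sub, map_smul, LinearMap.add_apply, LinearMap.sub_apply,
      LinearMap.smul_apply, smul_eq_mul, hv, hva]
    linear_combination ha
  · simp only [splitOne_apply, map_add, map_sub, map_smul,
      LinearMap.sub_apply, LinearMap.smul_apply, smul_eq_mul, hv, hva, hvb, hba]
    intro h
    refine one_ne_zero (α := k) ?_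
    linear_combination -h + hb -
      (form a (N b) - form b (N v) * form a (N v) + 1) * hab

/-- A nonalternating symmetric form is an orthogonal sum of lines. -/
lemma exists_orthonormal [IsAlgClosed k] (hsym : ∀ v w, form v (N w) = form w (N v))
    (hna : ∃ v, form v (N v) ≠ 0) :
    ∃ (r : ℕ) (w : Fin r → Fin n ⊕ Fin n → k), LinearIndependent k w ∧
      (∀ i, w i ∈ LinearMap.range N) ∧ ∀ t, N t = ∑ i, form t (w i) • w i := by
  induction hd : Module.finrank k (LinearMap.range N) using Nat.strong_induction_on
    generalizing N with
  | _ d ih =>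
    obtain ⟨v, hv, h⟩ := exists_splitOne hsym hna
    obtain ⟨hlt, hnot⟩ := range_splitOne_lt hsym hv
    have hN : ∀ t, N t = form t (N v) • N v + splitOne N (N v) t := fun t => by
      rw [splitOne_apply, add_sub_cancel]
    rcases h with h | h
    · refine ⟨1, fun _ => N v, ?_, fun _ => ⟨v, rfl⟩, fun t => ?_⟩
      · rw [linearIndependent_unique_iff]
        intro h0
        rw [h0] at hv
        simp at hv
      · simpa [h] using hN t
    · obtain ⟨r, w, hw, hwr, hws⟩ := ih _ (hd ▸ Submodule.finrank_lt_finrank_of_lt hlt)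
        (splitOne_symm hsym _) h rfl
      refine ⟨r + 1, Fin.cons (N v) w, linearIndependent_finCons.2 ⟨hw, fun h => hnot ?_⟩,
        fun i => ?_, fun t => ?_⟩
      · exact Submodule.span_le.2 (Set.range_subset_iff.2 hwr) h
      · refine Fin.cases ⟨v, rfl⟩ (fun i => hlt.le (hwr i)) i
      · rw [hN, hws, Fin.sum_univ_succ]
        rfl

/-- The pairing of consecutive indices. -/
def pairMatrix (k : Type*) [Field k] (i j : ℕ) : k := if i ≠ j ∧ i / 2 = j / 2 then 1 else 0

/-- An alternating form is an orthogonal sum of hyperbolic planes. -/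
lemma exists_symplectic_basis (hsym : ∀ v w, form v (N w) = form w (N v))
    (halt : ∀ v, form v (N v) = 0) :
    ∃ (m : ℕ) (w : Fin (2 * m) → Fin n ⊕ Fin n → k), LinearIndependent k w ∧
      (∀ i, w i ∈ LinearMap.range N) ∧
      ∀ t, N t = ∑ i : Fin (2 * m), ∑ j : Fin (2 * m), (pairMatrix k i j * form t (w i)) • w j := by
  induction hd : Module.finrank k (LinearMap.range N) using Nat.strong_induction_on
    generalizing N with
  | _ d ih =>
    by_cases h0 : N = 0
    · have : IsEmpty (Fin (2 * 0)) := Fin.isEmpty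
      exact ⟨0, fun i => i.elim0, linearIndependent_empty_type, fun i => i.elim0,
        fun t => by simp [h0]⟩
    have hab : ∃ a b, form a (N b) = 1 := by
      by_contra! h
      refine h0 (LinearMap.ext fun b => eq_zero_of_form fun a => ?_)
      by_contra hab
      refine h ((form a (N b))⁻¹ • a) b ?_
      rw [map_smul, LinearMap.smul_apply, smul_eq_mul, inv_mul_cancel₀ hab]
    obtain ⟨a, b, hab⟩ := hab
    have hba : form b (N a) = 1 := (hsym b a).trans hab
    have hsplit := splitTwo_apply N (N a) (N b)
    have hle : LinearMap.range (splitTwo N (N a) (N b)) ≤ LinearMap.range N := by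
      rintro _ ⟨t, rfl⟩
      rw [hsplit, ← map_smul, ← map_smul, ← map_sub, ← map_sub]
      exact ⟨_, rfl⟩
    have ha : ∀ x ∈ LinearMap.range (splitTwo N (N a) (N b)), form a x = 0 := by
      rintro _ ⟨t, rfl⟩
      rw [hsplit, map_sub, map_sub, map_smul, map_smul, halt, hab, hsym a t]
      simp
    have hb : ∀ x ∈ LinearMap.range (splitTwo N (N a) (N b)), form b x = 0 := by
      rintro _ ⟨t, rfl⟩
      rw [hsplit, map_sub, map_sub, map_smul, map_smul, halt, hba, hsym b t]
      simp
    have hlt : LinearMap.range (splitTwo N (N a) (N b)) < LinearMap.range N := by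
      refine lt_of_le_of_ne hle fun h => ?_
      have := ha (N b) (h ▸ ⟨b, rfl⟩)
      rw [hab] at this
      exact one_ne_zero this
    obtain ⟨m, w, hw, hwr, hws⟩ := ih _ (hd ▸ Submodule.finrank_lt_finrank_of_lt hlt)
      (N := splitTwo N (N a) (N b))
      (fun v w => by
        simp only [hsplit, map_sub, map_smul, smul_eq_mul, hsym v w]
        ring)
      (fun v => by
        simp only [hsplit, map_sub, map_smul, smul_eq_mul, halt]
        linear_combination (-(form v (N a) * form v (N b))) * (CharTwo.two_eq_zero (R := k))) rfl
    have hN : ∀ t, N t = form t (N b) • N a + form t (N a) • N b +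
        splitTwo N (N a) (N b) t := fun t => by
      rw [hsplit]
      abel
    have hspan : Submodule.span k (Set.range w) ≤ LinearMap.range (splitTwo N (N a) (N b)) :=
      Submodule.span_le.2 (Set.range_subset_iff.2 hwr)
    refine ⟨m + 1, (Fin.cons (N a) (Fin.cons (N b) w) : Fin (2 * m + 2) → _), ?_, ?_, ?_⟩
    · refine linearIndependent_finCons.2 ⟨linearIndependent_finCons.2 ⟨hw, fun h => ?_⟩,
        fun h => ?_⟩
      · have := ha _ (hspan h)
        rw [hab] at this
        exact one_ne_zero this
      · rw [Fin.range_cons, Submodule.mem_span_insert] at h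
        obtain ⟨c, x, hx, hc⟩ := h
        have := congrArg (form b) hc
        rw [map_add, map_smul, halt, hb _ (hspan hx), hba] at this
        simp at this
    · refine Fin.cases ⟨a, rfl⟩ (Fin.cases ⟨b, rfl⟩ fun i => hlt.le (hwr i))
    · intro t
      have hsum : ∑ i : Fin (2 * m + 2), ∑ j : Fin (2 * m + 2), (pairMatrix k i j * form t
          ((Fin.cons (N a) (Fin.cons (N b) w) : Fin (2 * m + 2) → Fin n ⊕ Fin n → k) i)) •
          (Fin.cons (N a) (Fin.cons (N b) w) : Fin (2 * m + 2) → Fin n ⊕ Fin n → k) j =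
          form t (N a) • N b + form t (N b) • N a +
            ∑ i : Fin (2 * m), ∑ j : Fin (2 * m), (pairMatrix k i j * form t (w i)) • w j := by
        have h₁ : ∀ i : ℕ, pairMatrix k 0 (i + 1 + 1) = 0 := fun i => if_neg (by omega)
        have h₂ : ∀ i : ℕ, pairMatrix k (0 + 1) (i + 1 + 1) = 0 := fun i => if_neg (by omega)
        have h₁' : ∀ i : ℕ, pairMatrix k (i + 1 + 1) 0 = 0 := fun i => if_neg (by omega)
        have h₂' : ∀ i : ℕ, pairMatrix k (i + 1 + 1) (0 + 1) = 0 := fun i => if_neg (by omega)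
        have h₃ : ∀ i j : ℕ, pairMatrix k (i + 1 + 1) (j + 1 + 1) = pairMatrix k i j :=
          fun i j => if_congr (by omega) rfl rfl
        have h₄ : pairMatrix k 0 0 = 0 := if_neg (by omega)
        have h₅ : pairMatrix k (0 + 1) (0 + 1) = 0 := if_neg (by omega)
        have h₆ : pairMatrix k 0 (0 + 1) = 1 := if_pos (by omega)
        have h₇ : pairMatrix k (0 + 1) 0 = 1 := if_pos (by omega)
        simp only [Fin.sum_univ_succ, Fin.cons_zero, Fin.cons_succ, Fin.val_zero, Fin.val_succ,
          h₁, h₂, h₁', h₂', h₃, h₄, h₅, h₆, h₇]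
        simp [add_assoc]
      refine (hN t).trans (Eq.trans ?_ hsum.symm)
      rw [hws]
      abel

/-- The representatives of classes of involutions. -/
def IsNormalForm (S : Matrix (Fin n) (Fin n) k) : Prop :=
  ∃ r ≤ n, (∀ i j, S i j = if (i : ℕ) < r ∧ (j : ℕ) < r then (if i = j then 1 else 0) else 0) ∨
    (Even r ∧ ∀ i j, S i j = if (i : ℕ) < r ∧ (j : ℕ) < r then pairMatrix k i j else 0)

/-- Every involution is conjugate to a lower triangular normal form. -/
lemma exists_conj_eq_lower [IsAlgClosed k] {u : SpGroup k n} (hu : u ^ 2 = 1) :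
    ∃ (g : SpGroup k n) (S : Matrix (Fin n) (Fin n) k) (hS : S.IsSymm),
      g * u * g⁻¹ = lower S hS ∧ IsNormalForm S := by
  set N : Module.End k (Fin n ⊕ Fin n → k) := Matrix.toLin' (mat u - 1) with hNdef
  have hN : ∀ t, mat u *ᵥ t = t + N t := fun t => by
    rw [hNdef, Matrix.toLin'_apply, Matrix.sub_mulVec, Matrix.one_mulVec, add_sub_cancel]
  have huu : ∀ t, mat u *ᵥ (mat u *ᵥ t) = t := fun t => by
    rw [Matrix.mulVec_mulVec, ← mat_mul, ← pow_two, hu, mat_one, Matrix.one_mulVec]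
  have hNN : ∀ t, N (N t) = 0 := fun t => by
    have := apply_apply_eq (T := Matrix.toLin' (mat u)) (N := N) (fun v => hN v) t
    rw [Matrix.toLin'_apply, Matrix.toLin'_apply, huu] at this
    simpa using this
  have hsym : ∀ v w, form v (N w) = form w (N v) := fun v w => by
    have h₁ : form v (mat u *ᵥ w) = form w (mat u *ᵥ v) := by
      rw [← form_mat u, huu, form_comm]
    rw [hN, hN, map_add, map_add, form_comm v w] at h₁
    exact add_left_cancel h₁
  have hiso : ∀ x ∈ LinearMap.range N, ∀ y ∈ LinearMap.range N, form x y = 0 := by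
    rintro _ ⟨a, rfl⟩ _ ⟨b, rfl⟩
    rw [hsym, hNN, map_zero]
  have hrank : ∀ (r : ℕ) (w : Fin r → Fin n ⊕ Fin n → k), LinearIndependent k w →
      (∀ i, w i ∈ LinearMap.range N) → r ≤ n := fun r w hw hwr => by
    have h₁ : r ≤ Module.finrank k (LinearMap.range N) := by
      have : LinearIndependent k (fun i => (⟨w i, hwr i⟩ : LinearMap.range N)) :=
        LinearIndependent.of_comp (LinearMap.range N).subtype hw
      simpa using this.fintype_card_le_finrank
    have h₂ : LinearMap.range N ≤ LinearMap.ker N := by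
      rintro _ ⟨t, rfl⟩
      exact hNN t
    have h₃ := Submodule.finrank_mono h₂
    have h₄ := LinearMap.finrank_range_add_finrank_ker N
    simp only [Module.finrank_fintype_fun_eq_card, Fintype.card_sum, Fintype.card_fin] at h₄
    omega
  by_cases halt : ∀ v, form v (N v) = 0
  · obtain ⟨m, w, hw, hwr, hws⟩ := exists_symplectic_basis hsym halt
    have hr := hrank _ w hw hwr
    obtain ⟨g, S, hS, hgu, hS'⟩ := exists_conj_eq_lower_of_sum (u := u) hr hw
      (fun i j => hiso _ (hwr i) _ (hwr j)) (c := pairMatrix k)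
      (fun i j => by simp only [pairMatrix, ne_comm, eq_comm])
      (fun t => by rw [hN, hws])
    exact ⟨g, S, hS, hgu, _, hr, Or.inr ⟨even_two_mul m, hS'⟩⟩
  · push Not at halt
    obtain ⟨r, w, hw, hwr, hws⟩ := exists_orthonormal hsym halt
    have hr := hrank _ w hw hwr
    obtain ⟨g, S, hS, hgu, hS'⟩ := exists_conj_eq_lower_of_sum (u := u) hr hw
      (fun i j => hiso _ (hwr i) _ (hwr j)) (c := fun i j => if i = j then 1 else 0)
      (fun i j => by simp only [eq_comm])
      (fun t => by
        rw [hN, hws]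
        simp [← Fin.ext_iff, ite_mul, ite_smul])
    exact ⟨g, S, hS, hgu, _, hr, Or.inl (by simpa only [← Fin.ext_iff] using hS')⟩

end Involutions

end SympCharTwo

namespace SympCharTwo

section Transvections

variable {k n}

/-- Transvections as elements of the general linear group. -/
def tv (i j : Fin n) (h : i ≠ j) (c : k) : GL (Fin n) k where
  val := Matrix.transvection i j c
  inv := Matrix.transvection i j (-c)
  val_inv := by rw [Matrix.transvection_mul_transvection_same _ _ h]; simp
  inv_val := by rw [Matrix.transvection_mul_transvection_same _ _ h]; simp

@[simp] lemma val_tv (i j : Fin n) (h : i ≠ j) (c : k) :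
    (tv i j h c).1 = Matrix.transvection i j c := rfl

@[simp] lemma val_tv_inv (i j : Fin n) (h : i ≠ j) (c : k) :
    ((tv i j h c)⁻¹).1 = Matrix.transvection i j (-c) := rfl

lemma blockTriangular_tv {i j : Fin n} (h : i < j) (c : k) :
    (tv i j h.ne c).1.BlockTriangular id := by
  intro a b (hab : b < a)
  rw [val_tv, Matrix.transvection, Matrix.add_apply, Matrix.one_apply_ne hab.ne',
    Matrix.single_apply, if_neg, add_zero]
  rintro ⟨rfl, rfl⟩
  exact lt_asymm h hab

lemma tv_eq_commutator {i m j : Fin n} (hjm : j ≠ m) (hmi : m ≠ i) (hji : j ≠ i) (c : k) :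
    tv j i hji c = tv j m hjm 1 * tv m i hmi c * tv j m hjm (-1) * tv m i hmi (-c) := by
  refine Units.ext ?_
  simp only [Units.val_mul, val_tv, Matrix.transvection, Matrix.add_mul, Matrix.mul_add, one_mul,
    mul_one, Matrix.single_mul_single_same, Matrix.single_mul_single_of_ne _ _ _ _ hjm.symm,
    Matrix.single_mul_single_of_ne _ _ _ _ hji.symm,
    Matrix.single_mul_single_of_ne _ _ _ _ hmi.symm,
    add_zero, mul_neg, neg_mul, ← Matrix.single_neg]
  abel

lemma transpose_mul_mul_self_eq [CharP k 2] {S Y : Matrix (Fin n) (Fin n) k} (hS : S.IsSymm)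
    (h₁ : (S * Y).IsSymm) (h₂ : Yᵀ * S * Y = 0) : (1 + Y)ᵀ * S * (1 + Y) = S := by
  have h₃ : Yᵀ * S = S * Y := by
    rw [← h₁.eq, Matrix.transpose_mul, hS.eq]
  rw [Matrix.transpose_add, Matrix.transpose_one, Matrix.add_mul, Matrix.mul_add, Matrix.add_mul,
    Matrix.add_mul, h₂, h₃, one_mul, mul_one, mul_one, add_zero]
  ext a b
  simp only [Matrix.add_apply, add_assoc, CharTwo.add_self_eq_zero, add_zero]

lemma mul_single_apply (S : Matrix (Fin n) (Fin n) k) (i j a b : Fin n) (c : k) :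
    (S * Matrix.single i j c) a b = if b = j then S a i * c else 0 := by
  split_ifs with h
  · rw [h, Matrix.mul_single_apply_same]
  · exact Matrix.mul_single_apply_of_ne _ _ _ _ _ h _

lemma transpose_tv_mul_mul [CharP k 2] {S : Matrix (Fin n) (Fin n) k} (hS : S.IsSymm)
    {i j : Fin n} (hji : j ≠ i) (h : ∀ a, a ≠ i → S a j = 0) (c : k) :
    (tv j i hji c).1ᵀ * S * (tv j i hji c).1 = S := by
  refine transpose_mul_mul_self_eq hS ?_ ?_
  · ext a b
    simp only [Matrix.transpose_apply, mul_single_apply]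
    by_cases ha : a = i <;> by_cases hb : b = i <;> simp [ha, hb, h]
  · rw [mul_assoc]
    ext a b
    rw [Matrix.mul_apply]
    refine Finset.sum_eq_zero fun x _ => ?_
    rw [mul_single_apply, Matrix.transpose_apply, Matrix.single_apply]
    by_cases hx : j = x
    · subst hx
      simp [h _ hji]
    · simp [hx]

lemma transpose_tv_mul_tv_mul_mul [CharP k 2] {S : Matrix (Fin n) (Fin n) k} (hS : S.IsSymm)
    {i j i' j' : Fin n} (hji : j ≠ i) (hij' : i' ≠ j') (hjj' : j' ≠ j) (hii' : i ≠ i')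
    (hj'i : j' ≠ i)
    (h : ∀ a, S a j = if a = j' then 1 else 0) (h' : ∀ a, S a i' = if a = i then 1 else 0)
    (c : k) :
    (tv i' j' hij' c * tv j i hji c).1ᵀ * S * (tv i' j' hij' c * tv j i hji c).1 = S := by
  have hprod : (tv i' j' hij' c * tv j i hji c).1 =
      1 + (Matrix.single i' j' c + Matrix.single j i c) := by
    simp only [Units.val_mul, val_tv, Matrix.transvection, Matrix.add_mul, Matrix.mul_add,
      Matrix.single_mul_single_of_ne _ _ _ _ hjj', mul_one, one_mul]
    abel
  rw [hprod]
  refine transpose_mul_mul_self_eq hS ?_ ?_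
  · ext a b
    simp only [Matrix.transpose_apply, mul_add, Matrix.add_apply, mul_single_apply, h, h']
    by_cases h₁ : a = i <;> by_cases h₂ : b = i <;> by_cases h₃ : a = j' <;>
      by_cases h₄ : b = j' <;> simp_all
  · rw [mul_assoc]
    ext a b
    rw [Matrix.mul_apply]
    refine Finset.sum_eq_zero fun x _ => ?_
    simp only [Matrix.transpose_apply, mul_add, Matrix.add_apply, mul_single_apply, h, h',
      Matrix.single_apply]
    by_cases h₁ : x = i
    · subst h₁
      simp [hii'.symm, hji]
    · by_cases h₂ : x = j'
      · subst h₂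
        simp [hij', hjj'.symm]
      · simp [h₁, h₂]

/-- The orthogonal reflection along an isotropic vector. -/
def reflection [CharP k 2] (a : Fin n → k) (ha : a ⬝ᵥ a = 0) (q : k) : GL (Fin n) k :=
  have h : (1 + q • Matrix.vecMulVec a a) * (1 + q • Matrix.vecMulVec a a) = 1 := by
    rw [Matrix.add_mul, Matrix.mul_add, Matrix.mul_add, Matrix.mul_smul, Matrix.smul_mul,
      Matrix.mul_smul, Matrix.smul_mul, Matrix.vecMulVec_mul_vecMulVec, ha]
    ext i j
    simp [add_assoc, CharTwo.add_self_eq_zero]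
  ⟨_, _, h, h⟩

lemma val_reflection [CharP k 2] (a : Fin n → k) (ha : a ⬝ᵥ a = 0) (q : k) :
    (reflection a ha q).1 = 1 + q • Matrix.vecMulVec a a := rfl

lemma transpose_reflection_mul_mul [CharP k 2] {S : Matrix (Fin n) (Fin n) k} (hS : S.IsSymm)
    (a : Fin n → k) (ha : a ⬝ᵥ a = 0) (q : k) (h : S *ᵥ a = a) :
    (reflection a ha q).1ᵀ * S * (reflection a ha q).1 = S := by
  have hSa : S * (q • Matrix.vecMulVec a a) = q • Matrix.vecMulVec a a := by
    rw [Matrix.mul_smul, Matrix.mul_vecMulVec, h]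
  refine transpose_mul_mul_self_eq hS ?_ ?_
  · rw [hSa]
    ext i j
    simp [Matrix.vecMulVec_apply, mul_comm]
  · rw [mul_assoc, hSa, Matrix.transpose_smul, Matrix.transpose_vecMulVec, Matrix.smul_mul,
      Matrix.mul_smul, Matrix.vecMulVec_mul_vecMulVec, ha]
    ext i j
    simp

/-- Moving a normal form by a simple lower transvection can be undone in the group of upper
triangular matrices. -/
lemma exists_blockTriangular_stabilizer [CharP k 2] {S : Matrix (Fin n) (Fin n) k}
    (hS : S.IsSymm) (hn : IsNormalForm S) {i j : Fin n} (hij : (j : ℕ) = i + 1) (hji : j ≠ i)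
    {c : k} (hc : c ≠ 1) :
    ∃ b : GL (Fin n) k, b.1.BlockTriangular id ∧
      (b * tv j i hji c).1ᵀ * S * (b * tv j i hji c).1 = S := by
  have htriv : (∀ a, a ≠ i → S a j = 0) → ∃ b : GL (Fin n) k, b.1.BlockTriangular id ∧
      (b * tv j i hji c).1ᵀ * S * (b * tv j i hji c).1 = S := fun h =>
    ⟨1, Matrix.blockTriangular_one, by rw [one_mul]; exact transpose_tv_mul_mul hS hji h c⟩
  obtain ⟨r, hr, h | ⟨heven, h⟩⟩ := hn
  · by_cases hjr : (j : ℕ) < r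
    · set a : Fin n → k := Pi.single i 1 + Pi.single j 1 with ha
      have haa : a ⬝ᵥ a = 0 := by
        simp [ha, hji, hji.symm, CharTwo.add_self_eq_zero]
      have hSa : S *ᵥ a = a := by
        rw [ha, Matrix.mulVec_add, Matrix.mulVec_single_one, Matrix.mulVec_single_one]
        funext x
        simp only [Pi.add_apply, Matrix.col_apply, h, Pi.single_apply]
        have hir : (i : ℕ) < r := by omega
        by_cases h₁ : x = i
        · subst h₁
          simp [hji.symm, hir]
        · by_cases h₂ : x = j
          · subst h₂
            simp [hji, hjr]
          · simp [h₁, h₂]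
      have hc' : 1 + c ≠ 0 := fun h0 => hc (by
        rw [← CharTwo.neg_eq (1 : k)]
        linear_combination h0)
      refine ⟨reflection a haa (c / (1 + c)) * tv j i hji (-c), ?_, ?_⟩
      · intro x y (hyx : y < x)
        have hne : ∀ y : Fin n, y ≠ i → y ≠ j → a y = 0 := fun y h₁ h₂ => by simp [ha, h₁, h₂]
        have hai : a i = 1 := by simp [ha, hji.symm]
        have haj : a j = 1 := by simp [ha, hji]
        rw [Units.val_mul, val_tv, val_reflection]
        by_cases hy : y = i
        · subst hy
          rw [Matrix.mul_transvection_apply_same]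
          simp only [Matrix.add_apply, Matrix.smul_apply, Matrix.vecMulVec_apply, smul_eq_mul,
            hai, haj, Matrix.one_apply_ne hyx.ne']
          by_cases hx : x = j
          · subst hx
            rw [Matrix.one_apply_eq, haj]
            field_simp
            linear_combination (-c ^ 2) * CharTwo.two_eq_zero (R := k)
          · rw [Matrix.one_apply_ne hx, hne x hyx.ne' hx]
            ring
        · rw [Matrix.mul_transvection_apply_of_ne _ _ _ _ hy]
          simp only [Matrix.add_apply, Matrix.smul_apply, Matrix.vecMulVec_apply, smul_eq_mul,
            Matrix.one_apply_ne hyx.ne']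
          by_cases hyj : y = j
          · rw [hne x (by rintro rfl; rw [Fin.lt_def] at hyx; omega)
              (by rintro rfl; exact hyx.ne hyj)]
            ring
          · rw [hne y hy hyj]
            ring
      · have : tv j i hji (-c) * tv j i hji c = 1 := by
          refine Units.ext ?_
          rw [Units.val_mul, val_tv, val_tv, Matrix.transvection_mul_transvection_same _ _ hji]
          simp
        rw [mul_assoc (reflection _ _ _), this, mul_one]
        exact transpose_reflection_mul_mul hS a haa _ hSa
    · exact htriv fun a _ => by rw [h, if_neg fun h' => hjr h'.2]
  · by_cases hir : (j : ℕ) < r ∧ ¬ Even (i : ℕ)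
    · obtain ⟨hjr, hi⟩ := hir
      obtain ⟨t, ht⟩ := Nat.not_even_iff_odd.1 hi
      obtain ⟨s, hs⟩ := heven
      obtain ⟨i', hi'⟩ : ∃ i' : Fin n, (i' : ℕ) = 2 * t := ⟨⟨2 * t, by omega⟩, rfl⟩
      obtain ⟨j', hj'⟩ : ∃ j' : Fin n, (j' : ℕ) = 2 * t + 3 := ⟨⟨2 * t + 3, by omega⟩, rfl⟩
      have hlt : i' < j' := by rw [Fin.lt_def]; omega
      have hne : ∀ {a b : Fin n}, (a : ℕ) ≠ b → a ≠ b := fun h h' => h (congrArg _ h')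
      refine ⟨tv i' j' hlt.ne c, blockTriangular_tv hlt c,
        transpose_tv_mul_tv_mul_mul hS hji hlt.ne (hne (by omega)) (hne (by omega))
          (hne (by omega)) (fun a => ?_) (fun a => ?_) c⟩
      · rw [h, pairMatrix, ← ite_and]
        exact if_congr (by rw [Fin.ext_iff]; omega) rfl rfl
      · rw [h, pairMatrix, ← ite_and]
        exact if_congr (by rw [Fin.ext_iff]; omega) rfl rfl
    · refine htriv fun a ha => ?_
      have ha' : (a : ℕ) ≠ i := fun h => ha (Fin.ext h)
      rw [h, pairMatrix, ← ite_and]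
      refine if_neg fun h' => hir ⟨h'.1.2, fun hi => ?_⟩
      obtain ⟨t, ht⟩ := hi
      omega

end Transvections

end SympCharTwo

namespace SympCharTwo

section DenseOrbit

open Polynomial

variable {k n}

/-- The elements conjugating a set into itself. -/
def conjStable (Z : Set (SpGroup k n)) : Submonoid (SpGroup k n) where
  carrier := {g | ∀ z ∈ Z, g * z * g⁻¹ ∈ Z}
  one_mem' z hz := by simpa using hz
  mul_mem' {a b} ha hb z hz := by
    have := ha _ (hb z hz)
    simpa only [mul_inv_rev, mul_assoc] using this

lemma continuous_conj (g : SpGroup k n) : Continuous fun z : SpGroup k n => g * z * g⁻¹ :=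
  (((IsRegMap.const g).mul isRegMap_id).mul (IsRegMap.const g⁻¹)).continuous

lemma mem_conjStable_closure {Y : Set (SpGroup k n)} {g : SpGroup k n}
    (h : ∀ y ∈ Y, g * y * g⁻¹ ∈ closure Y) : g ∈ conjStable (closure Y) := fun _ hz =>
  closure_minimal (t := (fun z => g * z * g⁻¹) ⁻¹' closure Y) h
    (isClosed_closure.preimage (continuous_conj g)) hz

lemma mem_conjStable_conjOrbit {B : Subgroup (SpGroup k n)} (x : SpGroup k n)
    {b : SpGroup k n} (hb : b ∈ B) : b ∈ conjStable (closure (conjOrbit B x)) := by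
  refine mem_conjStable_closure ?_
  rintro _ ⟨b', hb', rfl⟩
  exact subset_closure ⟨b * b', B.mul_mem hb hb', by simp only [mul_inv_rev, mul_assoc]⟩

lemma self_mem_closure_conjOrbit (B : Subgroup (SpGroup k n)) (x : SpGroup k n) :
    x ∈ closure (conjOrbit B x) :=
  subset_closure ⟨1, B.one_mem, by simp⟩

lemma isSymm_mul_mul (P : Matrix (Fin n) (Fin n) k) {S : Matrix (Fin n) (Fin n) k}
    (hS : S.IsSymm) : (P * S * Pᵀ).IsSymm := by
  rw [Matrix.IsSymm, Matrix.transpose_mul, Matrix.transpose_mul, Matrix.transpose_transpose,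
    hS.eq, mul_assoc]

lemma levi_mul_upper (P : GL (Fin n) k) {S : Matrix (Fin n) (Fin n) k} (hS : S.IsSymm) :
    levi P * upper S hS = upper (P.1 * S * P.1ᵀ) (isSymm_mul_mul _ hS) * levi P := by
  refine mat_injective ?_
  have : P.1ᵀ * (P⁻¹).1ᵀ = 1 := by
    rw [← Matrix.transpose_mul, ← Units.val_mul, inv_mul_cancel]
    simp
  rw [mat_mul, mat_mul, mat_levi, mat_upper, mat_upper, Matrix.fromBlocks_multiply,
    Matrix.fromBlocks_multiply, mul_assoc _ P.1ᵀ (P⁻¹).1ᵀ, this]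
  simp

lemma isCurve_levi_tv (d : k[X]) {i j : Fin n} (h : j ≠ i) :
    IsCurve d fun c => levi (tv j i h c) := by
  have hr : ∀ {f : k → k}, IsRat d f → ∀ i j a b : Fin n,
      IsRat d fun c => Matrix.transvection i j (f c) a b := fun hf i j a b => by
    simp only [Matrix.transvection, Matrix.add_apply, Matrix.single_apply]
    refine (IsRat.const d _).add ?_
    split_ifs
    exacts [hf, IsRat.const d 0]
  rintro (a | a) (b | b)
  · exact hr (IsRat.id d) _ _ _ _
  · exact IsRat.const d 0
  · exact IsRat.const d 0
  · exact hr (IsRat.id d).neg _ _ _ _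

/-- A lower simple transvection moves past an upper triangular matrix. -/
lemma exists_tv_mul_eq {i j : Fin n} (hij : (j : ℕ) = i + 1) (hji : j ≠ i) {P : GL (Fin n) k}
    (hP : P.1.BlockTriangular id) {c : k} (hc : P.1 j j + c * P.1 i j ≠ 0) :
    ∃ (c' : k) (Q : GL (Fin n) k), Q.1.BlockTriangular id ∧
      tv j i hji c * P = Q * tv j i hji c' := by
  refine ⟨c * P.1 i i / (P.1 j j + c * P.1 i j),
    tv j i hji c * P * (tv j i hji (c * P.1 i i / (P.1 j j + c * P.1 i j)))⁻¹, ?_, by simp⟩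
  have hlt : ∀ {x y : Fin n}, y < x → P.1 x y = 0 := fun h => hP h
  intro x y (hyx : y < x)
  rw [Units.val_mul, Units.val_mul, val_tv_inv, val_tv]
  by_cases hy : y = i
  · subst hy
    rw [Matrix.mul_transvection_apply_same]
    by_cases hx : x = j
    · subst hx
      rw [Matrix.transvection_mul_apply_same, Matrix.transvection_mul_apply_same, hlt hyx]
      field_simp
      ring
    · rw [Matrix.transvection_mul_apply_of_ne _ _ _ _ hx,
        Matrix.transvection_mul_apply_of_ne _ _ _ _ hx, hlt hyx, hlt (x := x) (y := j)]
      · ring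
      · have : (x : ℕ) ≠ j := fun h => hx (Fin.ext h)
        rw [Fin.lt_def] at hyx ⊢
        omega
  · rw [Matrix.mul_transvection_apply_of_ne _ _ _ _ hy]
    by_cases hx : x = j
    · subst hx
      have : (y : ℕ) ≠ i := fun h => hy (Fin.ext h)
      rw [Matrix.transvection_mul_apply_same, hlt hyx, hlt]
      · ring
      · rw [Fin.lt_def] at hyx ⊢
        omega
    · rw [Matrix.transvection_mul_apply_of_ne _ _ _ _ hx, hlt hyx]

lemma diag_ne_zero {P : GL (Fin n) k} (hP : P.1.BlockTriangular id) (j : Fin n) :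
    P.1 j j ≠ 0 := by
  have h := (Matrix.isUnit_iff_isUnit_det _).1 P.isUnit |>.ne_zero
  rw [Matrix.det_of_isUpperTriangular hP] at h
  exact Finset.prod_ne_zero_iff.1 h j (Finset.mem_univ j)

variable [CharP k 2] [Infinite k] {S : Matrix (Fin n) (Fin n) k} (hS : S.IsSymm)

lemma levi_tv_mul_mul_inv_mem (hn : IsNormalForm S) {i j : Fin n} (hij : (j : ℕ) = i + 1)
    (hji : j ≠ i) (c : k) :
    levi (tv j i hji c) * lower S hS * (levi (tv j i hji c))⁻¹ ∈
      closure (conjOrbit (borel k n) (lower S hS)) := by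
  have hcurve := ((isCurve_levi_tv 1 hji).mul (IsCurve.const 1 (lower S hS))).mul
    (isCurve_levi_tv (k := k) 1 hji).inv
  refine hcurve.mem_of_isClosed isClosed_closure (e := X - 1) (X_sub_C_ne_zero 1)
    (fun s _ hs => ?_) (s := c) (by simp)
  obtain ⟨b, hb, hbS⟩ := exists_blockTriangular_stabilizer hS hn hij hji (c := s)
    fun h => hs (by simp [h])
  have h := levi_mul_lower _ hS hS hbS
  refine subset_closure ⟨(levi b)⁻¹, inv_mem (levi_mem_borel hb), ?_⟩
  rw [map_mul] at h
  rw [mul_inv_eq_iff_eq_mul, inv_inv, eq_comm, mul_assoc, mul_assoc, ← h]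
  simp only [mul_assoc, inv_mul_cancel_left]

lemma levi_simple_tv_mem (hn : IsNormalForm S) {i j : Fin n} (hij : (j : ℕ) = i + 1)
    (hji : j ≠ i) (c : k) :
    levi (tv j i hji c) ∈ conjStable (closure (conjOrbit (borel k n) (lower S hS))) := by
  refine mem_conjStable_closure ?_
  rintro _ ⟨b, hb, rfl⟩
  have hcurve := ((isCurve_levi_tv 1 hji).mul
    (IsCurve.const 1 (b * lower S hS * b⁻¹))).mul (isCurve_levi_tv (k := k) 1 hji).inv
  obtain ⟨P, T, hT, hP, rfl⟩ := exists_eq_of_mem_borel hb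
  refine hcurve.mem_of_isClosed isClosed_closure (e := C (P.1 j j) + C (P.1 i j) * X)
    (fun h => diag_ne_zero hP j (by simpa using congrArg (eval 0) h))
    (fun s _ hs => ?_) (s := c) (by simp)
  obtain ⟨c', Q, hQ, h⟩ := exists_tv_mul_eq hij hji hP (c := s) (by
    rwa [eval_add, eval_mul, eval_C, eval_C, eval_X, mul_comm (P.1 i j)] at hs)
  have hmul : levi (tv j i hji s) * (levi P * upper T hT) =
      levi Q * upper _ (isSymm_mul_mul (tv j i hji c').1 hT) * levi (tv j i hji c') := by
    rw [← mul_assoc, ← map_mul, h, map_mul, mul_assoc, levi_mul_upper]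
    exact (mul_assoc _ _ _).symm
  have := mem_conjStable_conjOrbit (lower S hS)
    (mul_mem (levi_mem_borel hQ) (upper_mem_borel (isSymm_mul_mul (tv j i hji c').1 hT))) _
    (levi_tv_mul_mul_inv_mem hS hn hij hji c')
  convert this using 1
  have hl : ∀ a b x : SpGroup k n, a * (b * x * b⁻¹) * a⁻¹ = a * b * x * (a * b)⁻¹ :=
    fun a b x => by simp only [mul_inv_rev, mul_assoc]
  rw [hl, hl, hmul]

lemma levi_mem_conjStable (hn : IsNormalForm S) (P : GL (Fin n) k) :
    levi P ∈ conjStable (closure (conjOrbit (borel k n) (lower S hS))) := by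
  set M := conjStable (closure (conjOrbit (borel k n) (lower S hS)))
  have hlow : ∀ (d : ℕ) (i j : Fin n) (hji : j ≠ i) (c : k), (j : ℕ) = i + (d + 1) →
      levi (tv j i hji c) ∈ M := by
    intro d
    induction d with
    | zero => exact fun i j hji c hij => levi_simple_tv_mem hS hn hij hji c
    | succ d ih =>
      intro i j hji c hij
      obtain ⟨m, hm⟩ : ∃ m : Fin n, (m : ℕ) = i + 1 := ⟨⟨i + 1, by omega⟩, rfl⟩
      have hmi : m ≠ i := fun h => by rw [h] at hm; omega
      have hjm : j ≠ m := fun h => by rw [h] at hij; omega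
      rw [tv_eq_commutator hjm hmi hji, map_mul, map_mul, map_mul]
      exact mul_mem (mul_mem (mul_mem (ih _ _ _ _ (by omega))
        (levi_simple_tv_mem hS hn hm hmi _)) (ih _ _ _ _ (by omega)))
        (levi_simple_tv_mem hS hn hm hmi _)
  have hup : ∀ Q : GL (Fin n) k, Q.1.BlockTriangular id → levi Q ∈ M := fun Q hQ =>
    mem_conjStable_conjOrbit _ (levi_mem_borel hQ)
  refine Matrix.diagonal_transvection_induction_of_det_ne_zero
    (fun A => ∀ Q : GL (Fin n) k, Q.1 = A → levi Q ∈ M) P.1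
    ((Matrix.isUnit_iff_isUnit_det _).1 P.isUnit).ne_zero ?_ ?_ ?_ P rfl
  · exact fun D _ Q hQ => hup Q (hQ ▸ Matrix.blockTriangular_diagonal D)
  · rintro ⟨i, j, hij, c⟩ Q hQ
    obtain rfl : Q = tv i j hij c := Units.ext hQ
    rcases lt_or_gt_of_ne hij with h | h
    · exact hup _ (blockTriangular_tv h c)
    · obtain ⟨d, hd⟩ := Nat.exists_eq_add_of_lt h
      exact hlow d _ _ _ _ hd
  · intro A B hA hB ihA ihB Q hQ
    have : Q = Matrix.GeneralLinearGroup.mkOfDetNeZero A hA *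
        Matrix.GeneralLinearGroup.mkOfDetNeZero B hB := Units.ext hQ
    rw [this, map_mul]
    exact mul_mem (ihA _ rfl) (ihB _ rfl)

lemma conj_mem_of_det_ne_zero (hn : IsNormalForm S) {g : SpGroup k n}
    (h : (mat g).toBlocks₂₂.det ≠ 0) :
    g * lower S hS * g⁻¹ ∈ closure (conjOrbit (borel k n) (lower S hS)) := by
  obtain ⟨T, hT, P, T', hT', rfl⟩ := exists_eq_upper_mul_levi_mul_lower h
  have hmem := mul_mem (mem_conjStable_conjOrbit (lower S hS) (upper_mem_borel hT))
    (levi_mem_conjStable hS hn P) _ (self_mem_closure_conjOrbit _ _)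
  convert hmem using 1
  rw [mul_assoc _ (lower T' hT') (lower S hS), lower_mul_comm hT' hS, mul_inv_rev (_ * _),
    ← mul_assoc, ← mul_assoc, mul_assoc _ (lower T' hT'), mul_inv_cancel, mul_one]

/-- The standard Borel subgroup has a dense orbit on the class of a normal form. -/
lemma conjClass_subset_closure (hn : IsNormalForm S) :
    conjClass (lower S hS) ⊆ closure (conjOrbit (borel k n) (lower S hS)) := by
  intro y hy
  obtain ⟨g, rfl⟩ := isConj_iff.1 hy
  have hli : LinearIndependent k
      fun i : Fin n => (Pi.single (Sum.inr i) 1 : Fin n ⊕ Fin n → k) := by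
    simpa [Function.comp_def, Pi.basisFun_apply] using
      (Pi.basisFun k (Fin n ⊕ Fin n)).linearIndependent.comp _ Sum.inr_injective
  have hiso : ∀ i j : Fin n, form (Pi.single (Sum.inr i) 1 : Fin n ⊕ Fin n → k)
      (Pi.single (Sum.inr j) 1) = 0 := fun i j => by simp [form_single]
  obtain ⟨h, ⟨φ, hφ, hφ0, hφ1⟩, hgh⟩ := exists_isJoined_mulVec_eq n
    (fun i => (Pi.single (Sum.inr i) 1 : Fin n ⊕ Fin n → k))
    (fun i => mat g *ᵥ Pi.single (Sum.inr i) 1) hli (linearIndependent_mat_mulVec g hli) hiso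
    (fun i j => by rw [form_mat, hiso])
  have hfix : ∀ a j, mat (h⁻¹ * g) a (Sum.inr j) = (Pi.single (Sum.inr j) 1 : _ → k) a := by
    intro a j
    have : mat (h⁻¹ * g) *ᵥ Pi.single (Sum.inr j) 1 = Pi.single (Sum.inr j) 1 := by
      rw [mat_mul, ← Matrix.mulVec_mulVec, ← hgh, mat_inv_mulVec_mulVec]
    rw [← this, Matrix.mulVec_single_one]
    rfl
  obtain ⟨T, hT, hT'⟩ := exists_eq_lower (g := h⁻¹ * g)
    (by
      ext i j
      refine (hfix _ _).trans ?_
      simp [Pi.single_apply, Matrix.one_apply])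
    (by
      ext i j
      refine (hfix _ _).trans ?_
      simp)
  have hg : g * lower S hS * g⁻¹ = h * lower S hS * h⁻¹ := by
    rw [inv_mul_eq_iff_eq_mul.1 hT', mul_assoc h, lower_mul_comm hT hS, mul_inv_rev]
    simp only [mul_assoc, mul_inv_cancel_left]
  rw [hg, ← hφ1]
  obtain ⟨e, he⟩ := (IsRat.det (A := fun s => (mat (φ s)).toBlocks₂₂)
    fun a b => hφ (Sum.inr a) (Sum.inr b)).exists_eval
  refine ((hφ.mul (IsCurve.const 1 _)).mul hφ.inv).mem_of_isClosed isClosed_closure (e := e)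
    ?_ (fun s _ hs => conj_mem_of_det_ne_zero hS hn (by rwa [he])) (by simp)
  rintro rfl
  have := he 0
  rw [hφ0, mat_one, ← Matrix.fromBlocks_one, Matrix.toBlocks_fromBlocks₂₂] at this
  simp at this

end DenseOrbit

end SympCharTwo

/-- Let `k` be an algebraically closed field of characteristic 2 and let
`G = Sp(2n, k)` with `n ≥ 2`. A non-trivial unipotent conjugacy class `O` of `G` is
spherical if and only if `O` consists of involutions, i.e. iff every `u ∈ O` satisfies
`u² = 1`. -/
theorem spherical_iff_involutions_symplectic_char_two
    (k : Type*) [Field k] [IsAlgClosed k] (hchar : ringChar k = 2)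
    (n : ℕ) (hn : 2 ≤ n)
    (u : SpGroup k n) (hu : u ≠ 1)
    (hunip : IsNilpotent
      (((u : GL (Fin n ⊕ Fin n) k) : Matrix (Fin n ⊕ Fin n) (Fin n ⊕ Fin n) k) - 1)) :
    IsSphericalClass (SpGroup k n) (conjClass u) ↔ ∀ v ∈ conjClass u, v ^ 2 = 1 := by
  have : CharP k 2 := ringChar.of_eq hchar
  have : Infinite k := IsAlgClosed.instInfinite
  constructor
  · rintro ⟨B, hB, x, -, hd⟩ v hv
    obtain ⟨g, rfl⟩ := isConj_iff.1 hv
    rw [conj_pow, SympCharTwo.sq_eq_one_of_dense_orbit hn hB.2.1.isPreconnected hB.2.2.1 hunip hd,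
      mul_one, mul_inv_cancel]
  · intro h
    obtain ⟨g, S, hS, hg, hnf⟩ := SympCharTwo.exists_conj_eq_lower (h u (IsConj.refl u))
    have hu' : IsConj u (SympCharTwo.lower S hS) := isConj_iff.2 ⟨g, hg⟩
    exact ⟨SympCharTwo.borel k n, SympCharTwo.isBorel_borel, SympCharTwo.lower S hS, hu',
      fun v hv => SympCharTwo.conjClass_subset_closure hS hnf (hu'.symm.trans hv)⟩
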